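/- arXiv:1605.04142 — 2 statements merged into one kernel-verified Lean document; each statement's English description precedes it below -/
import Mathlib

section
/- Let X be a normal topological space and A, B subspaces with X = A ∪ B. Then the covering dimension satisfies dim X ≤ dim A + dim B + 1. -/
/-- `CovDimLE X n` : the covering dimension of `X` is at most `n`, i.e. every finite open
cover of `X` admits a finite open refinement in which no point lies in more than `n + 1`
sets. -/
def CovDimLE (X : Type*) [TopologicalSpace X] (n : ℕ) : Prop :=
  ∀ (m : ℕ) (U : Fin m → Set X), (∀ i, IsOpen (U i)) → (⋃ i, U i) = Set.univ →
    ∃ (k : ℕ) (V : Fin k → Set X), (∀ j, IsOpen (V j)) ∧ (⋃ j, V j) = Set.univ ∧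
      (∀ j, ∃ i, V j ⊆ U i) ∧ ∀ x : X, {j | x ∈ V j}.ncard ≤ n + 1

/-- A finite family of open sets covering a subspace of dimension at most `n` shrinks to a family
of open sets of the ambient space, still covering the subspace, of order at most `n + 1` on it. -/
theorem CovDimLE.exists_open_shrinking {X : Type*} [TopologicalSpace X] {S : Set X} {n m : ℕ}
    (hS : CovDimLE S n) (U : Fin m → Set X) (hU : ∀ i, IsOpen (U i)) (hSU : S ⊆ ⋃ i, U i) :
    ∃ V : Fin m → Set X, (∀ i, IsOpen (V i)) ∧ (∀ i, V i ⊆ U i) ∧ S ⊆ ⋃ i, V i ∧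
      ∀ x ∈ S, {i | x ∈ V i}.ncard ≤ n + 1 := by
  obtain ⟨k, V, hVo, hVc, hVU, hVn⟩ := hS m (fun i => (Subtype.val : S → X) ⁻¹' U i)
    (fun i => (hU i).preimage continuous_subtype_val) (by
      refine Set.eq_univ_of_forall fun x => ?_
      simpa using hSU x.2)
  choose f hf using hVU
  choose V' hV'o hV' using fun j => isOpen_induced_iff.mp (hVo j)
  have mem_V (j : Fin k) (x : S) : x ∈ V j ↔ (x : X) ∈ V' j := by rw [← hV' j]; rfl
  refine ⟨fun i => U i ∩ ⋃ j ∈ {j | f j = i}, V' j,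
    fun i => (hU i).inter (isOpen_biUnion fun j _ => hV'o j),
    fun i => Set.inter_subset_left, fun x hx => ?_, fun x hx => ?_⟩
  · obtain ⟨j, hj⟩ := Set.mem_iUnion.mp (hVc.symm ▸ Set.mem_univ (⟨x, hx⟩ : S))
    refine Set.mem_iUnion.mpr ⟨f j, hf j hj, ?_⟩
    exact Set.mem_biUnion (show f j = f j from rfl) ((mem_V j ⟨x, hx⟩).mp hj)
  · refine le_trans ?_ (hVn ⟨x, hx⟩)
    refine le_trans (Set.ncard_le_ncard ?_ (Set.toFinite _)) (Set.ncard_image_le (f := f)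
      (Set.toFinite _))
    rintro i ⟨-, hi⟩
    obtain ⟨j, hj, hxj⟩ := Set.mem_iUnion₂.mp hi
    exact ⟨j, (mem_V j ⟨x, hx⟩).mpr hxj, hj⟩

/-- The order of a finite family of open sets on a set bounds its order on the closure. -/
theorem ncard_mem_le_of_mem_closure {X ι : Type*} [TopologicalSpace X] [Finite ι] {S : Set X}
    {n : ℕ} {V : ι → Set X} (hV : ∀ i, IsOpen (V i)) (h : ∀ x ∈ S, {i | x ∈ V i}.ncard ≤ n)
    {x : X} (hx : x ∈ closure S) : {i | x ∈ V i}.ncard ≤ n := by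
  obtain ⟨y, hy, hyS⟩ := mem_closure_iff.mp hx (⋂ i ∈ {i | x ∈ V i}, V i)
    ((Set.toFinite _).isOpen_biInter fun i _ => hV i) (Set.mem_iInter₂.mpr fun _ hi => hi)
  exact (Set.ncard_le_ncard (fun i hi => Set.mem_iInter₂.mp hy i hi) (Set.toFinite _)).trans
    (h y hyS)

/-- The set where a finite family of closed sets has order at most `n` is open. -/
theorem isOpen_setOf_ncard_mem_le {X ι : Type*} [TopologicalSpace X] [Finite ι]
    {K : ι → Set X} (hK : ∀ i, IsClosed (K i)) (n : ℕ) :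
    IsOpen {x | {i | x ∈ K i}.ncard ≤ n} := by
  refine isOpen_iff_forall_mem_open.mpr fun x hx => ⟨⋂ i ∈ {i | x ∉ K i}, (K i)ᶜ, ?_,
    (Set.toFinite _).isOpen_biInter fun i _ => (hK i).isOpen_compl,
    Set.mem_iInter₂.mpr fun _ hi => hi⟩
  intro y hy
  refine (Set.ncard_le_ncard (fun i hi => ?_) (Set.toFinite _)).trans hx
  by_contra hxi
  exact Set.mem_iInter₂.mp hy i hxi hi

/-- In a normal space, a finite open family covering a closed set `F`, of order at most `n` on `F`,
shrinks to an open family covering `F` of order at most `n` everywhere. -/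
theorem exists_open_shrinking_ncard_le {X ι : Type*} [TopologicalSpace X] [NormalSpace X]
    [Finite ι] {F : Set X} (hF : IsClosed F) {n : ℕ} {V : ι → Set X} (hV : ∀ i, IsOpen (V i))
    (hFV : F ⊆ ⋃ i, V i) (h : ∀ x ∈ F, {i | x ∈ V i}.ncard ≤ n) :
    ∃ H : ι → Set X, (∀ i, IsOpen (H i)) ∧ (∀ i, H i ⊆ V i) ∧ F ⊆ ⋃ i, H i ∧
      ∀ x, {i | x ∈ H i}.ncard ≤ n := by
  obtain ⟨G, hFG, hGo, hGV⟩ := exists_subset_iUnion_closure_subset hF hV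
    (fun _ _ => Set.toFinite _) hFV
  refine ⟨fun i => G i ∩ {x | {i | x ∈ closure (G i)}.ncard ≤ n},
    fun i => (hGo i).inter (isOpen_setOf_ncard_mem_le (fun _ => isClosed_closure) n),
    fun i => Set.inter_subset_left.trans (subset_closure.trans (hGV i)), fun x hx => ?_,
    fun x => ?_⟩
  · obtain ⟨i, hi⟩ := Set.mem_iUnion.mp (hFG hx)
    exact Set.mem_iUnion.mpr ⟨i, hi,
      (Set.ncard_le_ncard (fun j hj => hGV j hj) (Set.toFinite _)).trans (h x hx)⟩
  · by_cases hx : {i | x ∈ closure (G i)}.ncard ≤ n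
    · exact (Set.ncard_le_ncard (fun j hj => (subset_closure hj.1 : x ∈ closure (G j)))
        (Set.toFinite _)).trans hx
    · simp [hx]

/-- If `X = A ∪ B` is normal, every finite open cover of `X` shrinks to an open cover of order
at most `dim A + dim B + 2` on the closure of `A`. -/
theorem exists_open_shrinking_closure_left {X : Type*} [TopologicalSpace X] [NormalSpace X]
    {A B : Set X} (hAB : A ∪ B = Set.univ) {a b : ℕ} (hA : CovDimLE A a) (hB : CovDimLE B b)
    {m : ℕ} (U : Fin m → Set X) (hU : ∀ i, IsOpen (U i)) (hUc : (⋃ i, U i) = Set.univ) :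
    ∃ W : Fin m → Set X, (∀ i, IsOpen (W i)) ∧ (∀ i, W i ⊆ U i) ∧ (⋃ i, W i) = Set.univ ∧
      ∀ x ∈ closure A, {i | x ∈ W i}.ncard ≤ a + b + 1 + 1 := by
  obtain ⟨V, hVo, hVU, hAV, hVn⟩ := hA.exists_open_shrinking U hU (by simp [hUc])
  obtain ⟨V', hV'o, hV'U, hBV', hV'n⟩ := hB.exists_open_shrinking U hU (by simp [hUc])
  have hFB : closure A \ ⋃ i, V i ⊆ B := fun x hx =>
    (hAB.symm ▸ Set.mem_univ x : x ∈ A ∪ B).resolve_left fun hxA => hx.2 (hAV hxA)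
  obtain ⟨H, hHo, hHV', hFH, hHn⟩ := exists_open_shrinking_ncard_le
    (isClosed_closure.sdiff (isOpen_iUnion hVo)) hV'o (hFB.trans hBV')
    (fun x hx => hV'n x (hFB hx))
  refine ⟨fun i => U i \ closure A ∪ (V i ∪ H i),
    fun i => ((hU i).sdiff isClosed_closure).union ((hVo i).union (hHo i)),
    fun i => Set.union_subset Set.sdiff_subset
      (Set.union_subset (hVU i) ((hHV' i).trans (hV'U i))),
    Set.eq_univ_of_forall fun x => ?_, fun x hx => ?_⟩
  · by_cases hx : x ∈ closure A
    · by_cases hxV : x ∈ ⋃ i, V i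
      · obtain ⟨i, hi⟩ := Set.mem_iUnion.mp hxV
        exact Set.mem_iUnion.mpr ⟨i, .inr (.inl hi)⟩
      · obtain ⟨i, hi⟩ := Set.mem_iUnion.mp (hFH ⟨hx, hxV⟩)
        exact Set.mem_iUnion.mpr ⟨i, .inr (.inr hi)⟩
    · obtain ⟨i, hi⟩ := Set.mem_iUnion.mp (hUc.symm ▸ Set.mem_univ x)
      exact Set.mem_iUnion.mpr ⟨i, .inl ⟨hi, hx⟩⟩
  · have hsub : {i | x ∈ U i \ closure A ∪ (V i ∪ H i)} ⊆ {i | x ∈ V i} ∪ {i | x ∈ H i} :=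
      fun i hi => hi.resolve_left fun h => h.2 hx
    refine (Set.ncard_le_ncard hsub (Set.toFinite _)).trans ?_
    refine (Set.ncard_union_le _ _).trans ?_
    have hVx := ncard_mem_le_of_mem_closure hVo hVn hx
    have hHx := hHn x
    omega

/-- For a normal space `X = A ∪ B`,
`dim X ≤ dim A + dim B + 1` (covering dimension). -/
theorem stmt11 {X : Type*} [TopologicalSpace X] [NormalSpace X]
    (A B : Set X) (hAB : A ∪ B = Set.univ) (a b : ℕ)
    (hA : CovDimLE A a) (hB : CovDimLE B b) : CovDimLE X (a + b + 1) := by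
  intro m U hU hUc
  obtain ⟨V, hVo, hVU, hVc, hVn⟩ := exists_open_shrinking_closure_left hAB hA hB U hU hUc
  obtain ⟨W, hWo, hWV, hWc, hWn⟩ := exists_open_shrinking_closure_left
    ((Set.union_comm B A).trans hAB) hB hA V hVo hVc
  refine ⟨m, W, hWo, hWc, fun i => ⟨i, (hWV i).trans (hVU i)⟩, fun x => ?_⟩
  rcases (hAB.symm ▸ Set.mem_univ x : x ∈ A ∪ B) with hx | hx
  · exact (Set.ncard_le_ncard (fun i hi => hWV i hi) (Set.toFinite _)).trans
      (hVn x (subset_closure hx))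
  · have := hWn x (subset_closure hx)
    omega
end

section
/- The product of two stratifolds, with structure algebra 𝒞_{S×S'} consisting of functions smooth on each product of strata and locally factoring through products of local retractions, is the categorical product in the category of stratifolds: for morphisms f₁ : Z → S and f₂ : Z → S' of stratifolds, the map z ↦ (f₁(z), f₂(z)) is a morphism of stratifolds Z → S × S', and it is the unique morphism commuting with the projections. -/
open scoped Manifold

/-- The locally extendable functions on a subspace `Y ⊆ X`, relative to an algebra
`𝒞 ⊆ C⁰(X)`. -/
def locExt {X : Type*} [TopologicalSpace X] (𝒞 : Set C(X, ℝ)) (Y : Set X) :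
    Set C(Y, ℝ) :=
  {g | ∀ x : Y, ∃ V : Set Y, IsOpen V ∧ x ∈ V ∧ ∃ h ∈ 𝒞, ∀ y ∈ V, g y = h (y : X)}

/-- A morphism of differential (continuous) spaces: a continuous map pulling the
structure algebra of the target back into that of the source. -/
def IsMor {X Y : Type*} [TopologicalSpace X] [TopologicalSpace Y]
    (𝒜 : Set C(X, ℝ)) (ℬ : Set C(Y, ℝ)) (f : C(X, Y)) : Prop :=
  ∀ g ∈ ℬ, g.comp f ∈ 𝒜

/-- `r` is a local retraction onto `A` defined on the open set `U`: a morphism of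
differential spaces `(U, 𝒞_U) → (U ∩ A, 𝒞_{U∩A})` restricting to the identity on
`U ∩ A`. -/
def IsLocRetr {X : Type*} [TopologicalSpace X] (𝒞 : Set C(X, ℝ)) (A U : Set X)
    (r : C(U, ↥(U ∩ A))) : Prop :=
  (∀ a : U, (a : X) ∈ A → ((r a : X) = (a : X))) ∧
  IsMor (locExt 𝒞 U) (locExt 𝒞 (U ∩ A)) r

/-- A (finite-dimensional) stratifold structure on a topological space `S`: a locally
detectable, `C^∞`-closed ℝ-subalgebra `C ⊆ C⁰(S)`, together with the decomposition into
strata `Sⁱ` (each an `i`-dimensional smooth manifold), closed skeleta, restriction to a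
stratum inducing an isomorphism of stalks `𝒞ₓ ≅ C^∞(Sⁱ)ₓ`, local retractions near every
point, and bump functions. -/
structure Stratifold (S : Type*) [TopologicalSpace S] where
  C : Subalgebra ℝ C(S, ℝ)
  locallyDetectable : ∀ f : C(S, ℝ),
    (∀ x : S, ∃ U : Set S, IsOpen U ∧ x ∈ U ∧ ∃ g ∈ C, ∀ y ∈ U, f y = g y) → f ∈ C
  smoothClosed : ∀ (n : ℕ) (fs : Fin n → C(S, ℝ)), (∀ i, fs i ∈ C) →
    ∀ g : (Fin n → ℝ) → ℝ, ContDiff ℝ (⊤ : ℕ∞) g →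
      ∀ h : C(S, ℝ), (∀ x, h x = g fun i => fs i x) → h ∈ C
  strata : ℕ → Set S
  strata_cover : ⋃ i, strata i = Set.univ
  strata_disj : ∀ i j, i ≠ j → Disjoint (strata i) (strata j)
  finiteDim : ∃ n, ∀ i, n < i → strata i = ∅
  skeleta_closed : ∀ k, IsClosed (⋃ i ≤ k, strata i)
  charts : ∀ i, ChartedSpace (EuclideanSpace ℝ (Fin i)) (strata i)
  restrict_smooth : ∀ i, ∀ g ∈ C,
    haveI := charts i
    ContMDiff (𝓡 i) 𝓘(ℝ, ℝ) (⊤ : ℕ∞) fun z : strata i => g (z : S)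
  germ_surj : ∀ (i : ℕ) (x : strata i) (h : strata i → ℝ),
    (haveI := charts i; ContMDiff (𝓡 i) 𝓘(ℝ, ℝ) (⊤ : ℕ∞) h) →
    ∃ g ∈ C, ∃ V : Set (strata i), IsOpen V ∧ x ∈ V ∧ ∀ z ∈ V, g (z : S) = h z
  germ_inj : ∀ (i : ℕ) (x : strata i), ∀ g ∈ C, ∀ g' ∈ C,
    (∃ V : Set (strata i), IsOpen V ∧ x ∈ V ∧ ∀ z ∈ V, g (z : S) = g' (z : S)) →
    ∃ U : Set S, IsOpen U ∧ (x : S) ∈ U ∧ ∀ y ∈ U, g y = g' y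
  retr : ∀ (i : ℕ) (x : S), x ∈ strata i → ∃ U : Set S, IsOpen U ∧ x ∈ U ∧
    ∃ r : C(U, ↥(U ∩ strata i)), IsLocRetr (C : Set C(S, ℝ)) (strata i) U r
  bump : ∀ (x : S) (W : Set S), IsOpen W → x ∈ W →
    ∃ ρ ∈ C, (∀ p, 0 ≤ ρ p) ∧ ρ x ≠ 0 ∧ closure {p | ρ p ≠ 0} ⊆ W

/-- The structure algebra `𝒞_{S×S'}` of the product of two stratifolds: continuous
functions smooth on every product of strata `Sⁱ × S'ʲ` and locally factoring through
products of local retractions. -/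
def prodAlg {S S' : Type*} [TopologicalSpace S] [TopologicalSpace S']
    (T : Stratifold S) (T' : Stratifold S') : Set C(S × S', ℝ) :=
  {f | (∀ i j,
          haveI := T.charts i
          haveI := T'.charts j
          ContMDiff ((𝓡 i).prod (𝓡 j)) 𝓘(ℝ, ℝ) (⊤ : ℕ∞)
            fun p : T.strata i × T'.strata j => f ((p.1 : S), (p.2 : S'))) ∧
       ∀ (i j : ℕ) (x : S) (y : S'), x ∈ T.strata i → y ∈ T'.strata j →
         ∃ (U : Set S) (V : Set S'), IsOpen U ∧ x ∈ U ∧ IsOpen V ∧ y ∈ V ∧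
         ∃ (r : C(U, ↥(U ∩ T.strata i))) (r' : C(V, ↥(V ∩ T'.strata j))),
           IsLocRetr (T.C : Set C(S, ℝ)) (T.strata i) U r ∧
           IsLocRetr (T'.C : Set C(S', ℝ)) (T'.strata j) V r' ∧
           ∀ (a : U) (b : V), f ((↑(r a) : S), (↑(r' b) : S')) = f ((a : S), (b : S'))}

/-- The structure algebra of the product `S × ℝⁿ` of a stratifold with the manifold
`ℝⁿ` (local retraction on the second factor being the identity). -/
def prodAlgRn {S : Type*} [TopologicalSpace S] (T : Stratifold S) (n : ℕ) :
    Set C(S × EuclideanSpace ℝ (Fin n), ℝ) :=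
  {f | (∀ i,
          haveI := T.charts i
          ContMDiff ((𝓡 i).prod (𝓡 n)) 𝓘(ℝ, ℝ) (⊤ : ℕ∞)
            fun p : T.strata i × EuclideanSpace ℝ (Fin n) => f ((p.1 : S), p.2)) ∧
       ∀ (i : ℕ) (x : S), x ∈ T.strata i → ∀ y : EuclideanSpace ℝ (Fin n),
         ∃ U : Set S, IsOpen U ∧ x ∈ U ∧
         ∃ W : Set (EuclideanSpace ℝ (Fin n)), IsOpen W ∧ y ∈ W ∧
         ∃ r : C(U, ↥(U ∩ T.strata i)),
           IsLocRetr (T.C : Set C(S, ℝ)) (T.strata i) U r ∧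
           ∀ a : U, ∀ b ∈ W, f ((↑(r a) : S), b) = f ((a : S), b)}

/-- The structure algebra of the product `U × ℝⁿ` of an open substratifold `U ⊆ S` with
the manifold `ℝⁿ`.  Smoothness on a stratum of `U` is phrased via `ContMDiffOn` on the
corresponding open subset of the stratum of `S`. -/
def prodAlgOpen {S : Type*} [TopologicalSpace S] (T : Stratifold S) (U : Set S) (n : ℕ) :
    Set C(↥U × EuclideanSpace ℝ (Fin n), ℝ) :=
  {f | (∀ i,
          haveI := T.charts i
          ∃ G : ↥(T.strata i) × EuclideanSpace ℝ (Fin n) → ℝ,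
            ContMDiffOn ((𝓡 i).prod (𝓡 n)) 𝓘(ℝ, ℝ) (⊤ : ℕ∞) G {p | (p.1 : S) ∈ U} ∧
            ∀ (a : ↥U) (ha : (a : S) ∈ T.strata i) (v : EuclideanSpace ℝ (Fin n)),
              G (⟨(a : S), ha⟩, v) = f (a, v)) ∧
       ∀ (i : ℕ) (x : ↥U), (x : S) ∈ T.strata i → ∀ y : EuclideanSpace ℝ (Fin n),
         ∃ V : Set ↥U, IsOpen V ∧ x ∈ V ∧
         ∃ W : Set (EuclideanSpace ℝ (Fin n)), IsOpen W ∧ y ∈ W ∧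
         ∃ r : C(V, ↥(V ∩ {a : ↥U | (a : S) ∈ T.strata i})),
           IsLocRetr (locExt (T.C : Set C(S, ℝ)) U) {a : ↥U | (a : S) ∈ T.strata i} V r ∧
           ∀ a : V, ∀ b ∈ W, f ((↑(r a) : ↥U), b) = f ((a : ↥U), b)}

section

open scoped Topology ContDiff
open Set Filter

/-- The continuous linear map turning a continuous family of linear maps into a linear map
with values in continuous functions. -/
noncomputable def ContinuousMap.flipCLM (Y E F : Type*) [TopologicalSpace Y] [CompactSpace Y]
    [NormedAddCommGroup E] [NormedSpace ℝ E] [NormedAddCommGroup F] [NormedSpace ℝ F] :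
    C(Y, E →L[ℝ] F) →L[ℝ] E →L[ℝ] C(Y, F) :=
  LinearMap.mkContinuous₂ (E := C(Y, E →L[ℝ] F)) (F := E) (G := C(Y, F))
    (LinearMap.mk₂ ℝ (fun (Φ : C(Y, E →L[ℝ] F)) (e : E) => (⟨fun y => Φ y e, by fun_prop⟩ : C(Y, F)))
      (fun _ _ _ => by ext; simp) (fun _ _ _ => by ext; simp)
      (fun _ _ _ => by ext; simp) (fun _ _ _ => by ext; simp)) 1
    (fun Φ e => by
      rw [LinearMap.mk₂_apply, ContinuousMap.norm_le _ (by positivity)]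
      intro y
      rw [one_mul]
      exact (Φ y).le_of_opNorm_le (Φ.norm_coe_le_norm y) e)

@[simp]
theorem ContinuousMap.flipCLM_apply {Y E F : Type*} [TopologicalSpace Y] [CompactSpace Y]
    [NormedAddCommGroup E] [NormedSpace ℝ E] [NormedAddCommGroup F] [NormedSpace ℝ F]
    (Φ : C(Y, E →L[ℝ] F)) (e : E) (y : Y) : ContinuousMap.flipCLM Y E F Φ e y = Φ y e :=
  rfl

theorem eventually_forall_of_compactSpace {X Y : Type*} [TopologicalSpace X] [TopologicalSpace Y]
    [CompactSpace Y] {x : X} {p : X × Y → Prop} (h : ∀ y, ∀ᶠ q in 𝓝 (x, y), p q) :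
    ∀ᶠ x' in 𝓝 x, ∀ y, p (x', y) := by
  have := isCompact_univ.eventually_forall_of_forall_eventually (x₀ := x) (K := (univ : Set Y))
    (P := fun a b => p (a, b)) (fun y _ => h y)
  filter_upwards [this] with a ha y using ha y trivial

theorem ContinuousMap.continuousAt_of_uncurry {X Y F : Type*} [TopologicalSpace X]
    [TopologicalSpace Y] [CompactSpace Y] [PseudoMetricSpace F] {Γ : X → C(Y, F)} {x : X}
    (h : ∀ y, ContinuousAt (fun q : X × Y => Γ q.1 q.2) (x, y)) : ContinuousAt Γ x := by
  rw [Metric.continuousAt_iff']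
  intro ε hε
  have : ∀ᶠ x' in 𝓝 x, ∀ y, dist (Γ x' y) (Γ x y) < ε / 2 := by
    refine eventually_forall_of_compactSpace (p := fun q => dist (Γ q.1 q.2) (Γ x q.2) < ε / 2) ?_
    intro y
    have h2 : ContinuousAt (fun q : X × Y => dist (Γ q.1 q.2) (Γ x q.2)) (x, y) :=
      (h y).dist ((Γ x).continuous.continuousAt.comp continuousAt_snd)
    exact h2.eventually_lt_const (by simpa using hε)
  filter_upwards [this] with x' hx'
  exact ((ContinuousMap.dist_le (by positivity)).2 fun y => (hx' y).le).trans_lt (by linarith)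

/-- A family of functions that is locally the restriction of a jointly `C^n` function along a
continuous map of the (compact) parameter space is `C^n` as a map into continuous functions. -/
theorem ContinuousMap.contDiffAt_of_param {Y E' : Type*} [TopologicalSpace Y] [CompactSpace Y]
    [NormedAddCommGroup E'] [NormedSpace ℝ E'] {E : Type} [NormedAddCommGroup E]
    [NormedSpace ℝ E] (n : ℕ) {F : Type} [NormedAddCommGroup F] [NormedSpace ℝ F]
    {Γ : E → C(Y, F)} {u₀ : E}
    (h : ∀ y, ∃ (ψ : Y → E') (G : E × E' → F), (∀ᶠ y' in 𝓝 y, ContinuousAt ψ y') ∧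
      ContDiffAt ℝ n G (u₀, ψ y) ∧ ∀ᶠ q in 𝓝 (u₀, y), Γ q.1 q.2 = G (q.1, ψ q.2)) :
    ContDiffAt ℝ n Γ u₀ := by
  induction n generalizing F with
  | zero =>
    have key : ∀ᶠ u in 𝓝 u₀, ∀ y, ContinuousAt (fun q : E × Y => Γ q.1 q.2) (u, y) := by
      refine eventually_forall_of_compactSpace
        (p := fun r => ContinuousAt (fun q : E × Y => Γ q.1 q.2) r) fun y => ?_
      obtain ⟨ψ, G, hψ, hG, hΓ⟩ := h y
      have hφ : ContinuousAt (fun q : E × Y => (q.1, ψ q.2)) (u₀, y) :=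
        continuousAt_fst.prodMk (hψ.self_of_nhds.comp continuousAt_snd)
      have h1 := hφ.eventually (hG.eventually (by simp))
      have h2 : ∀ᶠ q in 𝓝 (u₀, y), ContinuousAt ψ q.2 := continuousAt_snd.eventually hψ
      filter_upwards [h1, h2, hΓ.eventually_nhds] with q hq1 hq2 hq3
      have : ContinuousAt (fun q : E × Y => G (q.1, ψ q.2)) q :=
        ContinuousAt.comp (f := fun q : E × Y => (q.1, ψ q.2)) hq1.continuousAt
          (continuousAt_fst.prodMk (hq2.comp continuousAt_snd))
      exact this.congr (hq3.mono fun _ h => h.symm)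
    refine contDiffAt_zero.2 ⟨_, key, fun u hu => ?_⟩
    exact (ContinuousMap.continuousAt_of_uncurry hu).continuousWithinAt
  | succ n ih =>
    classical
    let D : E → Y → E →L[ℝ] F := fun u y => fderiv ℝ (fun u' => Γ u' y) u
    let Γ' : E → C(Y, E →L[ℝ] F) := fun u =>
      if hc : Continuous (D u) then ⟨D u, hc⟩ else 0
    have loc : ∀ y, ∃ (ψ : Y → E') (G : E × E' → E →L[ℝ] F), (∀ᶠ y' in 𝓝 y, ContinuousAt ψ y') ∧
        ContDiffAt ℝ n G (u₀, ψ y) ∧ ∀ᶠ q in 𝓝 (u₀, y), D q.1 q.2 = G (q.1, ψ q.2) ∧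
          HasFDerivAt (fun u' => Γ u' q.2) (D q.1 q.2) q.1 ∧
          ContinuousAt (D q.1) q.2 := by
      intro y
      obtain ⟨ψ, G, hψ, hG, hΓ⟩ := h y
      have hφ : ContinuousAt (fun q : E × Y => (q.1, ψ q.2)) (u₀, y) :=
        continuousAt_fst.prodMk (hψ.self_of_nhds.comp continuousAt_snd)
      have hG' : ContDiffAt ℝ n
          (fun p => (fderiv ℝ G p).comp (ContinuousLinearMap.inl ℝ E E')) (u₀, ψ y) :=
        (hG.fderiv_right (m := n) (by norm_cast)).clm_comp contDiffAt_const
      refine ⟨ψ, _, hψ, hG', ?_⟩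
      have h1 := hφ.eventually (hG.eventually (by simp))
      have h1' := hφ.eventually (hG'.eventually (by simp))
      have h2 : ∀ᶠ q in 𝓝 (u₀, y), ContinuousAt ψ q.2 := continuousAt_snd.eventually hψ
      have h3 : ∀ᶠ q in 𝓝 (u₀, y), HasFDerivAt (fun u' => Γ u' q.2)
          ((fderiv ℝ G (q.1, ψ q.2)).comp (ContinuousLinearMap.inl ℝ E E')) q.1 := by
        filter_upwards [h1, hΓ.eventually_nhds] with q hq1 hq3
        have hd : HasFDerivAt G (fderiv ℝ G (q.1, ψ q.2)) (q.1, ψ q.2) :=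
          (hq1.differentiableAt (by simp)).hasFDerivAt
        have := HasFDerivAt.comp (f := fun e => (e, ψ q.2)) q.1 hd (hasFDerivAt_prodMk_left q.1 (ψ q.2))
        refine this.congr_of_eventuallyEq ?_
        have hc : ContinuousAt (fun u' : E => (u', q.2)) q.1 := by fun_prop
        exact hc.eventually hq3
      filter_upwards [h3, h3.eventually_nhds, h1', h2] with q hq3 hq3' hq1 hq2
      have e : D q.1 q.2 = (fderiv ℝ G (q.1, ψ q.2)).comp (ContinuousLinearMap.inl ℝ E E') :=
        hq3.fderiv
      refine ⟨e, e ▸ hq3, ?_⟩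
      have hc : ContinuousAt (fun y' : Y => (q.1, y')) q.2 := by fun_prop
      have : ContinuousAt (fun y' : Y =>
          (fderiv ℝ G (q.1, ψ y')).comp (ContinuousLinearMap.inl ℝ E E')) q.2 :=
        ContinuousAt.comp (f := fun y' : Y => (q.1, ψ y')) hq1.continuousAt
          (continuousAt_const.prodMk hq2)
      exact this.congr ((hc.eventually hq3').mono fun _ h => h.fderiv.symm)
    have hD : ∀ᶠ u in 𝓝 u₀, ∀ y, HasFDerivAt (fun u' => Γ u' y) (D u y) u ∧
        ContinuousAt (D u) y := by
      refine eventually_forall_of_compactSpace (p := fun q =>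
        HasFDerivAt (fun u' => Γ u' q.2) (D q.1 q.2) q.1 ∧ ContinuousAt (D q.1) q.2) fun y => ?_
      obtain ⟨ψ, G, -, -, hq⟩ := loc y
      exact hq.mono fun q h => h.2
    have hΓ' : ∀ᶠ u in 𝓝 u₀, ∀ y, Γ' u y = D u y := by
      filter_upwards [hD] with u hu y
      have : Continuous (D u) := continuous_iff_continuousAt.2 fun y => (hu y).2
      simp [Γ', this]
    have hC : ContDiffAt ℝ n Γ' u₀ := by
      refine ih fun y => ?_
      obtain ⟨ψ, G, hψ, hG, hq⟩ := loc y
      refine ⟨ψ, G, hψ, hG, ?_⟩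
      have hf : ContinuousAt (fun q : E × Y => q.1) (u₀, y) := continuousAt_fst
      have := hf.eventually hΓ'
      filter_upwards [hq, this] with q h1 h2
      rw [h2, h1.1]
    rw [Nat.cast_succ, contDiffAt_succ_iff_hasFDerivAt]
    refine ⟨ContinuousMap.flipCLM Y E F ∘ Γ', ?_,
      hC.continuousLinearMap_comp (ContinuousMap.flipCLM Y E F)⟩
    have hcont : ∀ᶠ u in 𝓝 u₀, ContinuousAt Γ' u :=
      (hC.eventually (by simp)).mono fun _ h => h.continuousAt
    refine ⟨_, (hD.and hΓ').eventually_nhds.and hcont, fun u hu => ?_⟩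
    obtain ⟨hu1, hu2⟩ := hu
    rw [hasFDerivAt_iff_isLittleO, Asymptotics.isLittleO_iff]
    intro c hc
    have hnear : ∀ᶠ u' in 𝓝 u, dist (Γ' u') (Γ' u) < c :=
      Metric.continuousAt_iff'.1 hu2 c hc
    obtain ⟨r, hr, hball⟩ := Metric.eventually_nhds_iff_ball.1 (hu1.and hnear)
    filter_upwards [Metric.ball_mem_nhds u hr] with u' hu'
    rw [ContinuousMap.norm_le _ (by positivity)]
    intro y
    have := (convex_ball u r).norm_image_sub_le_of_norm_hasFDerivWithin_le'
      (f := fun v => Γ v y) (f' := fun v => D v y) (φ := D u y) (C := c)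
      (fun v hv => ((hball v hv).1.1 y).1.hasFDerivWithinAt) (fun v hv => ?_)
      (Metric.mem_ball_self hr) hu'
    · simpa [(hball u (Metric.mem_ball_self hr)).1.2 y] using this
    · rw [← (hball v hv).1.2 y, ← (hball u (Metric.mem_ball_self hr)).1.2 y, ← dist_eq_norm]
      exact (ContinuousMap.dist_apply_le_dist y).trans (hball v hv).2.le

/-- A compact piece of a finite-dimensional `C^1` family in a normed space is mapped injectively
to a finite-dimensional space by some continuous linear map. -/
theorem exists_clm_injOn_image {E B : Type*} [NormedAddCommGroup E] [NormedSpace ℝ E]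
    [FiniteDimensional ℝ E] [NormedAddCommGroup B] [NormedSpace ℝ B] {K : Set E}
    (hK : IsCompact K) {Γ : E → B} (hΓ : ∀ u ∈ K, ContDiffAt ℝ 1 Γ u) :
    ∃ (m : ℕ) (L : B →L[ℝ] (Fin m → ℝ)), InjOn L (Γ '' K) := by
  set m := Module.finrank ℝ (E × E) + 1
  refine ⟨m, ?_⟩
  let v : E × E → B := fun q => Γ q.1 - Γ q.2
  have hv : ∀ q ∈ K ×ˢ K, ContDiffAt ℝ 1 v q := fun q hq =>
    ((hΓ _ hq.1).comp q contDiffAt_fst).sub ((hΓ _ hq.2).comp q contDiffAt_snd)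
  let S : Set (E × E) := {q | q ∈ K ×ˢ K ∧ v q ≠ 0}
  have hsep : ∀ q, ∃ μ : B →L[ℝ] ℝ, v q ≠ 0 → μ (v q) ≠ 0 := fun q => by
    by_cases h : v q = 0
    · exact ⟨0, fun h' => (h' h).elim⟩
    · obtain ⟨μ, hμ⟩ := SeparatingDual.exists_ne_zero (R := ℝ) h
      exact ⟨μ, fun _ => hμ⟩
  choose μ hμ using hsep
  obtain ⟨t, -, htc, ht⟩ := TopologicalSpace.countable_cover_nhdsWithin (s := S)
    (f := fun p => {q | μ p (v q) ≠ 0}) fun p hp =>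
      mem_nhdsWithin_of_mem_nhds <|
        ((μ p).continuous.continuousAt.comp (hv p hp.1).continuousAt).eventually_ne (hμ p hp.2)
  let Q : (E × E) → ℕ → Set (E × E) := fun p n =>
    {q | q ∈ K ×ˢ K ∧ 1 / ((n : ℝ) + 1) ≤ |μ p (v q)|}
  have hQ : ∀ p n, IsCompact (Q p n) := fun p n => by
    have hc : ContinuousOn (fun q => |μ p (v q)|) (K ×ˢ K) := fun q hq =>
      ((μ p).continuous.continuousAt.comp
        (hv q hq).continuousAt).abs.continuousWithinAt
    exact (hK.prod hK).of_isClosed_subset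
      (hc.preimage_isClosed_of_isClosed (hK.prod hK).isClosed isClosed_Ici) inter_subset_left
  let A : t × ℕ → Set (B →L[ℝ] (Fin m → ℝ)) := fun i => {L | ∀ q ∈ Q i.1 i.2, L (v q) ≠ 0}
  have hopen : ∀ i, IsOpen (A i) := fun i => by
    refine isOpen_iff_mem_nhds.2 fun L₀ hL₀ => ?_
    refine (hQ i.1 i.2).eventually_forall_of_forall_eventually (x₀ := L₀)
      (P := fun L q => L (v q) ≠ 0) fun q hq => ?_
    have : ContinuousAt (fun z : (B →L[ℝ] (Fin m → ℝ)) × (E × E) => z.1 (v z.2)) (L₀, q) :=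
      continuousAt_fst.clm_apply
        (ContinuousAt.comp (f := Prod.snd) (g := v) (hv q hq.1).continuousAt continuousAt_snd)
    exact this.eventually_ne (hL₀ q hq)
  have hdense : ∀ i, Dense (A i) := fun i L₀ => by
    let p : E × E := i.1
    let O : Set (E × E) := {q | q ∈ K ×ˢ K ∧ μ p (v q) ≠ 0}
    let Ψ : E × E → (Fin m → ℝ) := fun q => -((μ p (v q))⁻¹ • L₀ (v q))
    have hΨ : ∀ q ∈ O, ∃ C, ∃ s ∈ 𝓝[O] q, LipschitzOnWith C Ψ s := fun q hq => by
      have h1 : ContDiffAt ℝ 1 (fun q => μ p (v q)) q := (μ p).contDiff.contDiffAt.comp q (hv q hq.1)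
      have h2 : ContDiffAt ℝ 1 (fun q => L₀ (v q)) q := L₀.contDiff.contDiffAt.comp q (hv q hq.1)
      obtain ⟨C, s, hs, hC⟩ := ((h1.inv hq.2).smul h2).neg.exists_lipschitzOnWith
      exact ⟨C, s, mem_nhdsWithin_of_mem_nhds hs, hC⟩
    have hdim : dimH (Ψ '' O) < Module.finrank ℝ (Fin m → ℝ) := by
      refine (dimH_image_le_of_locally_lipschitzOn hΨ).trans_lt ?_
      refine (dimH_mono (subset_univ O)).trans_lt ?_
      rw [Real.dimH_univ_eq_finrank]
      simp only [Module.finrank_prod, Module.finrank_fin_fun, m]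
      exact_mod_cast Nat.lt_succ_self _
    have h0 := dense_compl_of_dimH_lt_finrank hdim 0
    have hcont : Continuous fun a : Fin m → ℝ => L₀ + (μ p).smulRight a := by
      fun_prop
    have := map_mem_closure hcont h0 (t := A i) ?_
    · simpa using this
    · intro a ha q hq h
      refine ha ⟨q, ⟨hq.1, fun h0 => ?_⟩, ?_⟩
      · have := hq.2
        rw [show μ (i.1 : E × E) (v q) = 0 from h0, abs_zero] at this
        exact absurd this (not_le.2 (by positivity))
      · have hne : μ p (v q) ≠ 0 := fun h0 => by
          have := hq.2
          rw [show μ (i.1 : E × E) (v q) = 0 from h0, abs_zero] at this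
          exact absurd this (not_le.2 (by positivity))
        have h' : L₀ (v q) + μ p (v q) • a = 0 := h
        simp only [Ψ]
        rw [eq_neg_of_add_eq_zero_left h', smul_neg, neg_neg, inv_smul_smul₀ hne]
  have : Countable t := htc
  obtain ⟨L, hL⟩ := (dense_iInter_of_isOpen hopen hdense).nonempty
  refine ⟨L, ?_⟩
  rintro _ ⟨a, ha, rfl⟩ _ ⟨b, hb, rfl⟩ hab
  by_contra hne
  have hS : (a, b) ∈ S := ⟨⟨ha, hb⟩, sub_ne_zero.2 hne⟩
  obtain ⟨p, hp, hpq⟩ := mem_iUnion₂.1 (ht hS)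
  obtain ⟨n, hn⟩ := exists_nat_one_div_lt (abs_pos.2 hpq)
  exact mem_iInter.1 hL (⟨p, hp⟩, n) (a, b) ⟨hS.1, hn.le⟩ (by simp [v, hab])

theorem ContDiffBump.eventually_eq_zero {E : Type*} [NormedAddCommGroup E] [NormedSpace ℝ E]
    [HasContDiffBump E] {c : E} (χ : ContDiffBump c) {u : E}
    (hu : u ∉ Metric.closedBall c χ.rOut) : ∀ᶠ v in 𝓝 u, χ v = 0 := by
  filter_upwards [Metric.isClosed_closedBall.isOpen_compl.mem_nhds hu] with v hv
  exact χ.zero_of_le_dist (not_le.1 fun h => hv h).le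

theorem norm_smul_le_one {V : Type*} [SeminormedAddCommGroup V] [NormedSpace ℝ V] {b : ℝ} {v : V}
    (h0 : 0 ≤ b) (h1 : b ≤ 1) (hv : ‖v‖ ≤ 1) : ‖b • v‖ ≤ 1 := by
  rw [norm_smul, Real.norm_of_nonneg h0]
  exact mul_le_one₀ h1 (norm_nonneg _) hv

section Fourier
open MeasureTheory
open scoped FourierTransform

variable {E E' : Type*} [NormedAddCommGroup E] [InnerProductSpace ℝ E] [FiniteDimensional ℝ E]
  [MeasurableSpace E] [BorelSpace E] [NormedAddCommGroup E'] [InnerProductSpace ℝ E']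
  [FiniteDimensional ℝ E'] [MeasurableSpace E'] [BorelSpace E']

theorem exists_fourier_decay_of_contDiff {N : ℕ} {f : E → ℂ} (hf : ContDiff ℝ N f)
    (hs : HasCompactSupport f) : ∃ C, ∀ ξ, (1 + ‖ξ‖ ^ N) * ‖𝓕 f ξ‖ ≤ C := by
  have hi : ∀ k n : ℕ, (k : ℕ∞) ≤ (0 : ℕ∞) → (n : ℕ∞) ≤ (N : ℕ∞) →
      Integrable (fun v => ‖v‖ ^ k * ‖iteratedFDeriv ℝ n f v‖) := fun k n _ hn => by
    have hc := hf.continuous_iteratedFDeriv (m := n) (by exact_mod_cast hn)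
    refine Continuous.integrable_of_hasCompactSupport (by fun_prop) ?_
    exact ((hs.iteratedFDeriv n).norm).mul_left
  have h0 := Real.pow_mul_norm_iteratedFDeriv_fourier_le (K := 0) (N := (N : ℕ∞))
    (by exact_mod_cast hf) hi (k := 0) (n := 0) le_rfl (by simp)
  have h1 := Real.pow_mul_norm_iteratedFDeriv_fourier_le (K := 0) (N := (N : ℕ∞))
    (by exact_mod_cast hf) hi (k := 0) (n := N) le_rfl le_rfl
  simp only [norm_iteratedFDeriv_zero, pow_zero, one_mul] at h0 h1
  obtain ⟨a, ha⟩ : ∃ a, ∀ ξ, ‖𝓕 f ξ‖ ≤ a := ⟨_, h0⟩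
  obtain ⟨b, hb⟩ : ∃ b, ∀ ξ, ‖ξ‖ ^ N * ‖𝓕 f ξ‖ ≤ b := ⟨_, h1⟩
  refine ⟨a + b, fun ξ => ?_⟩
  rw [add_mul, one_mul]
  exact add_le_add (ha ξ) (hb ξ)

theorem exists_uniform_fourier_decay {B : Type*} [NormedAddCommGroup B] [NormedSpace ℝ B]
    {N : ℕ} {P : ℕ → E → B} (hP : ∀ n, Continuous (P n)) (hs : ∀ n, HasCompactSupport (P n))
    (h : ∀ μ : B →L[ℝ] ℝ, ∃ n, ContDiff ℝ N (fun u => μ (P n u))) :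
    ∃ n C, ∀ μ : B →L[ℝ] ℝ, ‖μ‖ ≤ 1 → ∀ ξ,
      (1 + ‖ξ‖ ^ N) * ‖𝓕 (fun u => ((μ (P n u) : ℝ) : ℂ)) ξ‖ ≤ C := by
  have hcont : ∀ n (μ : B →L[ℝ] ℝ), Continuous fun u => ((μ (P n u) : ℝ) : ℂ) := fun n μ =>
    Complex.continuous_ofReal.comp (μ.continuous.comp (hP n))
  have hsupp : ∀ n (μ : B →L[ℝ] ℝ), HasCompactSupport fun u => ((μ (P n u) : ℝ) : ℂ) := fun n μ =>
    (hs n).comp_left (g := fun b => ((μ b : ℝ) : ℂ)) (by simp)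
  let Φ : ℕ → (B →L[ℝ] ℝ) → E → ℂ := fun n μ => 𝓕 (fun u => ((μ (P n u) : ℝ) : ℂ))
  have hint : ∀ n (μ : B →L[ℝ] ℝ) (ξ : E),
      Integrable fun v => Real.fourierChar (-(inner ℝ v ξ)) • ((μ (P n v) : ℝ) : ℂ) :=
    fun n μ ξ => (Real.fourierIntegral_convergent_iff ξ).2
      ((hcont n μ).integrable_of_hasCompactSupport (hsupp n μ))
  have hsub : ∀ n (μ ν : B →L[ℝ] ℝ) ξ, Φ n (μ - ν) ξ = Φ n μ ξ - Φ n ν ξ := fun n μ ν ξ => by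
    simp only [Φ, Real.fourier_eq]
    rw [← integral_sub (hint n μ ξ) (hint n ν ξ)]
    simp [smul_sub]
  have hsmul : ∀ n (c : ℝ) (μ : B →L[ℝ] ℝ) ξ, Φ n (c • μ) ξ = c * Φ n μ ξ := fun n c μ ξ => by
    simp only [Φ, Real.fourier_eq]
    rw [← integral_const_mul]
    refine integral_congr_ae (Eventually.of_forall fun v => ?_)
    simp [Circle.smul_def]
    ring
  have hΦ : ∀ n ξ, Continuous fun μ => Φ n μ ξ := fun n ξ => by
    rw [← continuousOn_univ]
    refine continuousOn_integral_of_compact_support (hs n) ?_ ?_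
    · have h1 : Continuous fun q : (B →L[ℝ] ℝ) × E => q.1 (P n q.2) :=
        continuous_fst.clm_apply ((hP n).comp continuous_snd)
      have h2 : Continuous fun q : (B →L[ℝ] ℝ) × E => Real.fourierChar (-(inner ℝ q.2 ξ)) :=
        Real.continuous_fourierChar.comp (by fun_prop)
      exact (h2.smul (Complex.continuous_ofReal.comp h1)).continuousOn
    · intro μ v _ hv
      simp [image_eq_zero_of_notMem_tsupport hv]
  let A : ℕ × ℕ → Set (B →L[ℝ] ℝ) := fun i => {μ | ∀ ξ, (1 + ‖ξ‖ ^ N) * ‖Φ i.1 μ ξ‖ ≤ i.2}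
  have hA : ∀ i, IsClosed (A i) := fun i => by
    simp only [A, ofPred_forall]
    exact isClosed_iInter fun ξ =>
      isClosed_le (continuous_const.mul (hΦ i.1 ξ).norm) continuous_const
  have hU : ⋃ i, A i = univ := by
    refine eq_univ_of_forall fun μ => ?_
    obtain ⟨n, hn⟩ := h μ
    obtain ⟨C, hC⟩ := exists_fourier_decay_of_contDiff
      (f := fun u => ((μ (P n u) : ℝ) : ℂ)) (Complex.ofRealCLM.contDiff.comp hn) (hsupp n μ)
    obtain ⟨M, hM⟩ := exists_nat_ge C
    exact mem_iUnion.2 ⟨(n, M), fun ξ => (hC ξ).trans hM⟩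
  obtain ⟨⟨n, M⟩, μ₀, hμ₀⟩ := nonempty_interior_of_iUnion_of_closed hA hU
  obtain ⟨δ, hδ, hball⟩ := Metric.mem_nhds_iff.1 (mem_interior_iff_mem_nhds.1 hμ₀)
  refine ⟨n, 2 / δ * (M + M), fun μ hμ ξ => ?_⟩
  have hmem : μ₀ + (δ / 2) • μ ∈ Metric.ball μ₀ δ := by
    rw [mem_ball_iff_norm, add_sub_cancel_left, norm_smul, Real.norm_of_nonneg (by positivity)]
    nlinarith
  have h1 := hball hmem ξ
  have h2 := hball (Metric.mem_ball_self hδ) ξ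
  have h3 : μ = (2 / δ) • ((μ₀ + (δ / 2) • μ) - μ₀) := by
    rw [add_sub_cancel_left, smul_smul, show 2 / δ * (δ / 2) = 1 by field_simp, one_smul]
  change _ * ‖Φ n μ ξ‖ ≤ _
  rw [h3, hsmul, hsub, norm_mul, Complex.norm_real, Real.norm_of_nonneg (by positivity)]
  calc (1 + ‖ξ‖ ^ N) * (2 / δ * ‖Φ n (μ₀ + (δ / 2) • μ) ξ - Φ n μ₀ ξ‖)
      ≤ (1 + ‖ξ‖ ^ N) * (2 / δ * (‖Φ n (μ₀ + (δ / 2) • μ) ξ‖ + ‖Φ n μ₀ ξ‖)) := by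
        gcongr; exact norm_sub_le _ _
    _ = 2 / δ * ((1 + ‖ξ‖ ^ N) * ‖Φ n (μ₀ + (δ / 2) • μ) ξ‖ + (1 + ‖ξ‖ ^ N) * ‖Φ n μ₀ ξ‖) := by
        ring
    _ ≤ _ := by gcongr

theorem norm_fourier_prod_le {f : E × E' → ℂ} (hf : Continuous f) (hs : HasCompactSupport f)
    (ζ : WithLp 2 (E × E')) :
    ‖𝓕 (fun z : WithLp 2 (E × E') => f z.ofLp) ζ‖ ≤
        ∫ w, ‖𝓕 (fun u => f (u, w)) ζ.fst‖ ∧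
    ‖𝓕 (fun z : WithLp 2 (E × E') => f z.ofLp) ζ‖ ≤
        ∫ u, ‖𝓕 (fun w => f (u, w)) ζ.snd‖ := by
  have hmp := WithLp.volume_preserving_ofLp (U := E) (V := E')
  let g : E × E' → ℂ := fun q =>
    Real.fourierChar (-(inner ℝ q.1 ζ.fst)) • (Real.fourierChar (-(inner ℝ q.2 ζ.snd)) • f q)
  have hg : Integrable g := by
    refine Continuous.integrable_of_hasCompactSupport ?_ ?_
    · have c1 : Continuous fun q : E × E' => -(inner ℝ q.1 ζ.fst) := by fun_prop
      have c2 : Continuous fun q : E × E' => -(inner ℝ q.2 ζ.snd) := by fun_prop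
      exact (Real.continuous_fourierChar.comp c1).smul
        ((Real.continuous_fourierChar.comp c2).smul hf)
    · exact (hs.smul_left).smul_left
  have key : 𝓕 (fun z : WithLp 2 (E × E') => f z.ofLp) ζ = ∫ q, g q := by
    rw [Real.fourier_eq, ← hmp.integral_comp (MeasurableEquiv.toLp 2 (E × E')).symm.measurableEmbedding]
    refine integral_congr_ae (Eventually.of_forall fun z => ?_)
    simp only [g, WithLp.prod_inner_apply, neg_add, AddChar.map_add_eq_mul, mul_smul]
    rfl
  rw [key]
  constructor
  · rw [Measure.volume_eq_prod, integral_prod_symm _ hg]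
    refine (norm_integral_le_integral_norm _).trans_eq (integral_congr_ae (Eventually.of_forall fun w => ?_))
    simp only [g]
    have : ∀ u : E, Real.fourierChar (-(inner ℝ u ζ.fst)) • Real.fourierChar (-(inner ℝ w ζ.snd)) • f (u, w)
       = Real.fourierChar (-(inner ℝ w ζ.snd)) • Real.fourierChar (-(inner ℝ u ζ.fst)) • f (u, w) :=
      fun u => smul_comm _ _ _
    simp_rw [this, Circle.smul_def, integral_smul, norm_smul, Circle.norm_coe, one_mul]
    rfl
  · rw [Measure.volume_eq_prod, integral_prod _ hg]
    refine (norm_integral_le_integral_norm _).trans_eq (integral_congr_ae (Eventually.of_forall fun u => ?_))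
    simp only [g]
    simp_rw [Circle.smul_def, integral_smul, norm_smul, Circle.norm_coe, one_mul]
    rfl

theorem integral_norm_fourier_le {f : E × E' → ℂ} (hs : HasCompactSupport f) {N : ℕ} {C : ℝ}
    (h1 : ∀ w ξ, (1 + ‖ξ‖ ^ N) * ‖𝓕 (fun u => f (u, w)) ξ‖ ≤ C) :
    ∃ D, 0 ≤ D ∧ ∀ ξ, (1 + ‖ξ‖ ^ N) * ∫ w, ‖𝓕 (fun u => f (u, w)) ξ‖ ≤ D := by
  have hC : 0 ≤ C := le_trans (by positivity) (h1 0 0)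
  let Q : Set E' := Prod.snd '' tsupport f
  have hQ : IsCompact Q := IsCompact.image hs continuous_snd
  refine ⟨∫ w in Q, C, by positivity, fun ξ => ?_⟩
  have hz : ∀ w ∉ Q, ‖𝓕 (fun u => f (u, w)) ξ‖ = 0 := fun w hw => by
    have : (fun u => f (u, w)) = fun _ => 0 := funext fun u =>
      image_eq_zero_of_notMem_tsupport fun hm => hw ⟨_, hm, rfl⟩
    rw [this]; simp [Real.fourier_eq]
  rw [← setIntegral_eq_integral_of_forall_compl_eq_zero hz, ← integral_const_mul]
  refine integral_mono_of_nonneg (Eventually.of_forall fun w => by positivity) ?_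
    (Eventually.of_forall fun w => h1 w ξ)
  exact integrableOn_const hQ.measure_lt_top.ne

/-- A compactly supported continuous function of two variables whose partial Fourier transforms
decay fast enough, uniformly in the remaining variable, is `C^K`. -/
theorem contDiff_of_fourier_decay {f : E × E' → ℂ} (hf : Continuous f) (hs : HasCompactSupport f)
    {K N : ℕ} (hN : K + Module.finrank ℝ (WithLp 2 (E × E')) < N) {C C' : ℝ}
    (h1 : ∀ w ξ, (1 + ‖ξ‖ ^ N) * ‖𝓕 (fun u => f (u, w)) ξ‖ ≤ C)
    (h2 : ∀ u η, (1 + ‖η‖ ^ N) * ‖𝓕 (fun w => f (u, w)) η‖ ≤ C') : ContDiff ℝ K f := by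
  let F : WithLp 2 (E × E') → ℂ := fun z => f z.ofLp
  have hF : Continuous F := hf.comp (WithLp.prod_continuous_ofLp 2 E E')
  have hFs : HasCompactSupport F :=
    hs.comp_homeomorph (WithLp.homeomorphProd 2 E E')
  obtain ⟨D, hD0, hD⟩ := integral_norm_fourier_le hs h1
  obtain ⟨D', hD0', hD'⟩ := integral_norm_fourier_le (f := f ∘ Prod.swap)
    (hs.comp_homeomorph (Homeomorph.prodComm E' E)) h2
  have hdecay : ∀ ζ, ‖𝓕 F ζ‖ ≤ (4 ^ N * (D + D')) * (1 + ‖ζ‖) ^ (-(N : ℝ)) := fun ζ => by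
    obtain ⟨n1, n2⟩ := norm_fourier_prod_le hf hs ζ
    have e1 : (1 + ‖ζ.fst‖ ^ N) * ‖𝓕 F ζ‖ ≤ D + D' :=
      (mul_le_mul_of_nonneg_left n1 (by positivity)).trans ((hD _).trans (by linarith))
    have e2 : (1 + ‖ζ.snd‖ ^ N) * ‖𝓕 F ζ‖ ≤ D + D' :=
      (mul_le_mul_of_nonneg_left n2 (by positivity)).trans ((hD' _).trans (by linarith))
    have hmax : (1 + max ‖ζ.fst‖ ‖ζ.snd‖ ^ N) * ‖𝓕 F ζ‖ ≤ D + D' := by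
      rcases max_choice ‖ζ.fst‖ ‖ζ.snd‖ with h | h <;> rw [h] <;> assumption
    have hle : (1 + ‖ζ‖) ^ N ≤ 4 ^ N * (1 + max ‖ζ.fst‖ ‖ζ.snd‖ ^ N) := by
      have hn : ‖ζ‖ ≤ 2 * max ‖ζ.fst‖ ‖ζ.snd‖ := by
        rw [WithLp.prod_norm_eq_of_L2]
        have a1 := le_max_left ‖ζ.fst‖ ‖ζ.snd‖
        have a2 := le_max_right ‖ζ.fst‖ ‖ζ.snd‖
        refine Real.sqrt_le_iff.2 ⟨by positivity, ?_⟩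
        nlinarith [norm_nonneg ζ.fst, norm_nonneg ζ.snd]
      have hm : 0 ≤ max ‖ζ.fst‖ ‖ζ.snd‖ := by positivity
      calc (1 + ‖ζ‖) ^ N ≤ (2 * (1 + max ‖ζ.fst‖ ‖ζ.snd‖)) ^ N := by
            gcongr; linarith
        _ = 2 ^ N * (1 + max ‖ζ.fst‖ ‖ζ.snd‖) ^ N := mul_pow _ _ _
        _ ≤ 2 ^ N * (2 ^ (N - 1) * (1 ^ N + max ‖ζ.fst‖ ‖ζ.snd‖ ^ N)) := by
            gcongr; exact add_pow_le zero_le_one hm N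
        _ ≤ 2 ^ N * (2 ^ N * (1 ^ N + max ‖ζ.fst‖ ‖ζ.snd‖ ^ N)) := by
            gcongr <;> norm_num
        _ = _ := by
            rw [one_pow, ← mul_assoc, ← mul_pow]; norm_num
    rw [Real.rpow_neg (by positivity), Real.rpow_natCast, ← div_eq_mul_inv,
      le_div_iff₀ (by positivity)]
    calc ‖𝓕 F ζ‖ * (1 + ‖ζ‖) ^ N ≤ ‖𝓕 F ζ‖ * (4 ^ N * (1 + max ‖ζ.fst‖ ‖ζ.snd‖ ^ N)) := by gcongr
      _ = 4 ^ N * ((1 + max ‖ζ.fst‖ ‖ζ.snd‖ ^ N) * ‖𝓕 F ζ‖) := by ring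
      _ ≤ _ := by gcongr
  have hFi := hF.integrable_of_hasCompactSupport (μ := volume) hFs
  have hcF : Continuous (𝓕 F) := by
    refine VectorFourier.fourierIntegral_continuous Real.continuous_fourierChar ?_ hFi
    exact continuous_inner
  have hmom : ∀ n : ℕ, (n : ℕ∞) ≤ (K : ℕ∞) → Integrable fun ζ => ‖ζ‖ ^ n * ‖𝓕 F ζ‖ := fun n hn => by
    have hn' : n ≤ K := by exact_mod_cast hn
    have hr : (Module.finrank ℝ (WithLp 2 (E × E')) : ℝ) < (N : ℝ) - n := by
      rw [lt_sub_iff_add_lt]; exact_mod_cast (by omega)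
    refine ((integrable_one_add_norm (μ := volume) hr).const_mul (4 ^ N * (D + D'))).mono'
      (by fun_prop) (Eventually.of_forall fun ζ => ?_)
    rw [Real.norm_of_nonneg (by positivity)]
    calc ‖ζ‖ ^ n * ‖𝓕 F ζ‖ ≤ (1 + ‖ζ‖) ^ n * ((4 ^ N * (D + D')) * (1 + ‖ζ‖) ^ (-(N : ℝ))) := by
          gcongr; exacts [by linarith, hdecay ζ]
      _ = _ := by
          rw [neg_sub, sub_eq_add_neg, Real.rpow_add (by positivity), Real.rpow_natCast]; ring
  have hF' : ContDiff ℝ K F := by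
    have hi : Integrable (𝓕 F) := by
      have := hmom 0 (by simp)
      simp only [pow_zero, one_mul] at this
      exact (integrable_norm_iff hcF.aestronglyMeasurable).1 this
    rw [← hF.fourierInv_fourier_eq hFi hi, Real.fourierInv_eq_fourier_comp_neg]
    have h := Real.contDiff_fourier (f := fun x => 𝓕 F (-x)) (N := K) fun n hn => by
      simpa using (hmom n hn).comp_neg
    exact_mod_cast h
  have := hF'.comp (WithLp.prodContinuousLinearEquiv 2 ℝ E E').symm.contDiff
  exact this


theorem exists_bump_fourier_decay {B : Type*} [NormedAddCommGroup B] [NormedSpace ℝ B] {N : ℕ}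
    {P : E → B} {c : E} {ε : ℝ} (hε : 0 < ε) (hc : ∀ u ∈ Metric.ball c ε, ContinuousAt P u)
    (hs : ∀ μ : B →L[ℝ] ℝ, ContDiffAt ℝ N (fun u => μ (P u)) c) :
    ∃ (χ : ContDiffBump c) (C : ℝ), χ.rOut < ε ∧ ∀ μ : B →L[ℝ] ℝ, ‖μ‖ ≤ 1 → ∀ ξ,
      (1 + ‖ξ‖ ^ N) * ‖𝓕 (fun u => ((χ u * μ (P u) : ℝ) : ℂ)) ξ‖ ≤ C := by
  let χ : ℕ → ContDiffBump c := fun n =>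
    ⟨ε / (n + 2) / 2, ε / (n + 2), by positivity, half_lt_self (by positivity)⟩
  have hr : ∀ n, (χ n).rOut < ε := fun n => by
    refine div_lt_self hε ?_
    have : (0 : ℝ) ≤ n := n.cast_nonneg
    linarith
  have hsub : ∀ n, Metric.closedBall c (χ n).rOut ⊆ Metric.ball c ε := fun n =>
    Metric.closedBall_subset_ball (hr n)
  have hz : ∀ n u, u ∉ Metric.closedBall c (χ n).rOut → ∀ᶠ v in 𝓝 u, χ n v = 0 :=
    fun n u hu => (χ n).eventually_eq_zero hu
  have hcont : ∀ n, Continuous fun u => χ n u • P u := fun n => by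
    refine continuous_iff_continuousAt.2 fun u => ?_
    by_cases hu : u ∈ Metric.closedBall c (χ n).rOut
    · exact (χ n).continuous.continuousAt.smul (hc u (hsub n hu))
    · refine (continuousAt_const (y := (0 : B))).congr ?_
      filter_upwards [hz n u hu] with v hv
      simp [hv]
  obtain ⟨n, C, hC⟩ := exists_uniform_fourier_decay (N := N) (P := fun n u => χ n u • P u) hcont
    (fun n => (χ n).hasCompactSupport.smul_right) fun μ => by
      obtain ⟨r, hr0, hr⟩ := Metric.eventually_nhds_iff_ball.1 ((hs μ).eventually (by simp))
      obtain ⟨n, hn⟩ := exists_nat_gt (ε / r)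
      refine ⟨n, contDiff_iff_contDiffAt.2 fun u => ?_⟩
      simp only [map_smul, smul_eq_mul]
      by_cases hu : u ∈ Metric.closedBall c (χ n).rOut
      · refine (χ n).contDiff.contDiffAt.mul (hr u (Metric.closedBall_subset_ball ?_ hu))
        change ε / (n + 2) < r
        rw [div_lt_iff₀ (by positivity)]
        rw [div_lt_iff₀ hr0] at hn
        nlinarith
      · refine (contDiffAt_const (c := (0 : ℝ))).congr_of_eventuallyEq ?_
        filter_upwards [hz n u hu] with v hv
        simp [hv]
  exact ⟨χ n, C, hr n, by simpa only [map_smul, smul_eq_mul] using hC⟩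

/-- A function of two variables `(u, w)` which can be written both as the value at a vector
depending on `u`, weakly smooth in `u`, of a functional depending on `w`, and vice versa,
is smooth. -/
theorem contDiffAt_of_weakly_contDiffAt {B B' : Type*} [NormedAddCommGroup B] [NormedSpace ℝ B]
    [NormedAddCommGroup B'] [NormedSpace ℝ B'] {P : E → B} {P' : E' → B'} {δ : E' → B →L[ℝ] ℝ}
    {δ' : E → B' →L[ℝ] ℝ} {c : E} {c' : E'} (hδ : ∀ w, ‖δ w‖ ≤ 1) (hδ' : ∀ u, ‖δ' u‖ ≤ 1)
    (heq : ∀ᶠ q in 𝓝 (c, c'), δ q.2 (P q.1) = δ' q.1 (P' q.2))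
    (hc : ∀ᶠ u in 𝓝 c, ContinuousAt P u) (hc' : ∀ᶠ w in 𝓝 c', ContinuousAt P' w)
    (hs : ∀ μ : B →L[ℝ] ℝ, ContDiffAt ℝ ∞ (fun u => μ (P u)) c)
    (hs' : ∀ μ : B' →L[ℝ] ℝ, ContDiffAt ℝ ∞ (fun w => μ (P' w)) c') :
    ContDiffAt ℝ ∞ (fun q : E × E' => δ q.2 (P q.1)) (c, c') := by
  refine contDiffAt_infty.2 fun K => ?_
  set N := K + Module.finrank ℝ (WithLp 2 (E × E')) + 1
  have hcu : ∀ᶠ q : E × E' in 𝓝 (c, c'), ContinuousAt P q.1 := continuousAt_fst.eventually hc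
  have hcw : ∀ᶠ q : E × E' in 𝓝 (c, c'), ContinuousAt P' q.2 := continuousAt_snd.eventually hc'
  obtain ⟨ε, hε, hball⟩ := Metric.eventually_nhds_iff_ball.1 (heq.and (hcu.and hcw))
  have hball' : ∀ u ∈ Metric.ball c ε, ∀ w ∈ Metric.ball c' ε,
      δ w (P u) = δ' u (P' w) ∧ ContinuousAt P u ∧ ContinuousAt P' w := fun u hu w hw =>
    hball (u, w) (by rw [← ball_prod_same]; exact ⟨hu, hw⟩)
  obtain ⟨χ, C, hχ, hC⟩ := exists_bump_fourier_decay (N := N) hε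
    (fun u hu => (hball' u hu c' (Metric.mem_ball_self hε)).2.1)
    fun μ => (hs μ).of_le (by exact_mod_cast le_top)
  obtain ⟨χ', C', hχ', hC'⟩ := exists_bump_fourier_decay (N := N) hε
    (fun w hw => (hball' c (Metric.mem_ball_self hε) w hw).2.2)
    fun μ => (hs' μ).of_le (by exact_mod_cast le_top)
  let f : E × E' → ℂ := fun q => ((χ q.1 * χ' q.2 * δ q.2 (P q.1) : ℝ) : ℂ)
  have hsw : ∀ u w, χ u * χ' w * δ w (P u) = χ u * χ' w * δ' u (P' w) := fun u w => by
    by_cases hu : u ∈ Metric.ball c ε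
    · by_cases hw : w ∈ Metric.ball c' ε
      · rw [(hball' u hu w hw).1]
      · rw [χ'.zero_of_le_dist (hχ'.le.trans (not_lt.1 hw))]; simp
    · rw [χ.zero_of_le_dist (hχ.le.trans (not_lt.1 hu))]; simp
  have hd : ∀ u ∈ Metric.ball c ε, ∀ w ∈ Metric.ball c' ε,
      ContinuousAt (fun q : E × E' => δ q.2 (P q.1)) (u, w) := fun u hu w hw => by
    have h1 : Tendsto (fun q : E × E' => P q.1 - P u) (𝓝 (u, w)) (𝓝 0) := by
      have : ContinuousAt (fun q : E × E' => P q.1 - P u) (u, w) :=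
        (ContinuousAt.comp (f := Prod.fst) (g := P) (hball' u hu w hw).2.1
          continuousAt_fst).sub continuousAt_const
      simpa [ContinuousAt] using this
    have h2 : Tendsto (fun q : E × E' => P' q.2 - P' w) (𝓝 (u, w)) (𝓝 0) := by
      have : ContinuousAt (fun q : E × E' => P' q.2 - P' w) (u, w) :=
        (ContinuousAt.comp (f := Prod.snd) (g := P') (hball' u hu w hw).2.2
          continuousAt_snd).sub continuousAt_const
      simpa [ContinuousAt] using this
    rw [ContinuousAt, tendsto_iff_norm_sub_tendsto_zero]
    refine squeeze_zero' (Eventually.of_forall fun _ => norm_nonneg _) ?_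
      (by simpa using h1.norm.add h2.norm)
    have hw' : ∀ᶠ q : E × E' in 𝓝 (u, w), q.2 ∈ Metric.ball c' ε :=
      continuousAt_snd.eventually (Metric.isOpen_ball.mem_nhds hw)
    filter_upwards [hw'] with q hq
    have e : δ q.2 (P q.1) - δ w (P u) = δ q.2 (P q.1 - P u) + δ' u (P' q.2 - P' w) := by
      rw [map_sub, map_sub, ← (hball' u hu w hw).1, ← (hball' u hu q.2 hq).1]; ring
    rw [e]
    refine (norm_add_le _ _).trans (add_le_add ?_ ?_)
    · simpa using (δ q.2).le_of_opNorm_le (hδ _) (P q.1 - P u)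
    · simpa using (δ' u).le_of_opNorm_le (hδ' _) (P' q.2 - P' w)
  have hf : Continuous f := by
    refine Complex.continuous_ofReal.comp (continuous_iff_continuousAt.2 fun ⟨u, w⟩ => ?_)
    by_cases hu : u ∈ Metric.closedBall c χ.rOut
    · by_cases hw : w ∈ Metric.closedBall c' χ'.rOut
      · exact ((χ.continuous.comp continuous_fst).mul
          (χ'.continuous.comp continuous_snd)).continuousAt.mul
          (hd u (Metric.closedBall_subset_ball hχ hu) w (Metric.closedBall_subset_ball hχ' hw))
      · refine (continuousAt_const (y := (0 : ℝ))).congr ?_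
        have : ∀ᶠ q : E × E' in 𝓝 (u, w), χ' q.2 = 0 :=
          continuousAt_snd.eventually (χ'.eventually_eq_zero hw)
        filter_upwards [this] with q hq
        simp [hq]
    · refine (continuousAt_const (y := (0 : ℝ))).congr ?_
      have : ∀ᶠ q : E × E' in 𝓝 (u, w), χ q.1 = 0 :=
        continuousAt_fst.eventually (χ.eventually_eq_zero hu)
      filter_upwards [this] with q hq
      simp [hq]
  have hfs : HasCompactSupport f := by
    refine HasCompactSupport.intro
      ((isCompact_closedBall c χ.rOut).prod (isCompact_closedBall c' χ'.rOut)) fun q hq => ?_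
    rcases not_and_or.1 hq with h | h
    · simp [f, (χ.eventually_eq_zero h).self_of_nhds]
    · simp [f, (χ'.eventually_eq_zero h).self_of_nhds]
  have hcd : ContDiff ℝ K f := by
    refine contDiff_of_fourier_decay hf hfs (N := N) (Nat.lt_succ_self _) (C := C) (C' := C')
      (fun w ξ => ?_) fun u η => ?_
    · have e : (fun u => f (u, w)) = fun u => ((χ u * (χ' w • δ w) (P u) : ℝ) : ℂ) := by
        funext u
        simp only [f, smul_apply, smul_eq_mul]
        congr 1
        ring
      rw [e]
      exact hC _ (norm_smul_le_one χ'.nonneg χ'.le_one (hδ w)) ξ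
    · have e : (fun w => f (u, w)) = fun w => ((χ' w * (χ u • δ' u) (P' w) : ℝ) : ℂ) := by
        funext w
        simp only [f, smul_apply, smul_eq_mul, hsw]
        congr 1
        ring
      rw [e]
      exact hC' _ (norm_smul_le_one χ.nonneg χ.le_one (hδ' u)) η
  refine (Complex.reCLM.contDiff.comp hcd).contDiffAt.congr_of_eventuallyEq ?_
  have e1 : ∀ᶠ q : E × E' in 𝓝 (c, c'), χ q.1 = 1 :=
    continuousAt_fst.eventually (p := fun u => χ u = 1) χ.eventuallyEq_one
  have e2 : ∀ᶠ q : E × E' in 𝓝 (c, c'), χ' q.2 = 1 :=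
    continuousAt_snd.eventually (p := fun w => χ' w = 1) χ'.eventuallyEq_one
  filter_upwards [e1, e2] with q h1 h2
  simp [f, h1, h2]

end Fourier

section Manifold

variable {E E' : Type} [NormedAddCommGroup E] [NormedSpace ℝ E]
  [NormedAddCommGroup E'] [NormedSpace ℝ E'] {M N : Type*}
  [TopologicalSpace M] [ChartedSpace E M] [TopologicalSpace N] [ChartedSpace E' N]

theorem contMDiffAt_real_iff {F : Type*} [NormedAddCommGroup F] [NormedSpace ℝ F] {f : M → F}
    {x : M} : ContMDiffAt 𝓘(ℝ, E) 𝓘(ℝ, F) ∞ f x ↔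
      ContinuousAt f x ∧ ContDiffAt ℝ ∞ (f ∘ (chartAt E x).symm) (chartAt E x x) := by
  simp [contMDiffAt_iff, contDiffWithinAt_univ, chartAt_self_eq, Function.comp_def]

theorem contMDiff_curry_restrict {g : C(M × N, ℝ)}
    (hg : ContMDiff (𝓘(ℝ, E).prod 𝓘(ℝ, E')) 𝓘(ℝ, ℝ) ∞ g) (Y : Set N) [CompactSpace Y] :
    ContMDiff 𝓘(ℝ, E) 𝓘(ℝ, C(Y, ℝ)) ∞ fun x => (g.curry x).restrict Y := fun p => by
  have hcont : Continuous fun x => (g.curry x).restrict Y :=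
    (ContinuousMap.continuous_precomp
      (⟨Subtype.val, continuous_subtype_val⟩ : C(Y, N))).comp g.curry.continuous
  refine contMDiffAt_real_iff.2 ⟨hcont.continuousAt, contDiffAt_infty.2 fun n => ?_⟩
  refine ContinuousMap.contDiffAt_of_param (E' := E') n fun y => ?_
  refine ⟨fun y' => chartAt E' (y : N) y',
    fun q => g ((chartAt E p).symm q.1, (chartAt E' (y : N)).symm q.2), ?_, ?_, ?_⟩
  · filter_upwards [continuous_subtype_val.continuousAt.eventually
      ((chartAt E' (y : N)).open_source.mem_nhds (mem_chart_source E' (y : N)))] with y' hy'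
    exact ContinuousAt.comp (f := Subtype.val) (g := chartAt E' (y : N))
      ((chartAt E' (y : N)).continuousAt hy') continuous_subtype_val.continuousAt
  · have := (contMDiffAt_iff.1 (hg (p, (y : N)))).2
    simp only [ModelWithCorners.range_eq_univ, contDiffWithinAt_univ] at this
    have h := this.of_le (m := n) (by exact_mod_cast le_top)
    simp only [chartAt_self_eq, mfld_simps, Function.comp_def] at h
    exact h
  · have hc : ContinuousAt (fun q : E × Y => (q.2 : N)) (chartAt E p p, y) := by fun_prop
    filter_upwards [hc.eventually
      ((chartAt E' (y : N)).open_source.mem_nhds (mem_chart_source E' (y : N)))] with q hq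
    simp [(chartAt E' (y : N)).left_inv hq]

theorem contMDiff_comp_prodSwap {g : C(M × N, ℝ)}
    (hg : ContMDiff (𝓘(ℝ, E).prod 𝓘(ℝ, E')) 𝓘(ℝ, ℝ) ∞ g) :
    ContMDiff (𝓘(ℝ, E').prod 𝓘(ℝ, E)) 𝓘(ℝ, ℝ) ∞ (g.comp ContinuousMap.prodSwap) :=
  hg.comp (contMDiff_snd.prodMk contMDiff_fst)

/-- Near a point, finitely many smooth functions separate the points of the first factor as well
as a given smooth function of two variables does. -/
theorem exists_contMDiff_separating [FiniteDimensional ℝ E] {g : C(M × N, ℝ)}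
    (hg : ContMDiff (𝓘(ℝ, E).prod 𝓘(ℝ, E')) 𝓘(ℝ, ℝ) ∞ g) (x₀ : M) {Y : Set N}
    (hY : IsCompact Y) :
    ∃ (m : ℕ) (h : Fin m → M → ℝ), (∀ a, ContMDiff 𝓘(ℝ, E) 𝓘(ℝ, ℝ) ∞ (h a)) ∧
      ∀ᶠ q in 𝓝 (x₀, x₀), (∀ a, h a q.1 = h a q.2) → ∀ y ∈ Y, g (q.1, y) = g (q.2, y) := by
  have := isCompact_iff_compactSpace.1 hY
  have hΓ := contMDiff_curry_restrict hg Y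
  obtain ⟨r, hr, hball⟩ := Metric.eventually_nhds_iff_ball.1
    (((contMDiffAt_real_iff.1 (hΓ x₀)).2.of_le (m := 1) (by simp)).eventually (by simp))
  obtain ⟨m, L, hL⟩ := exists_clm_injOn_image
    (isCompact_closedBall (chartAt E x₀ x₀) (r / 2)) (fun u hu =>
      hball u (Metric.closedBall_subset_ball (half_lt_self hr) hu))
  refine ⟨m, fun a x => L ((g.curry x).restrict Y) a, fun a => ?_, ?_⟩
  · exact ((ContinuousLinearMap.proj (R := ℝ) (φ := fun _ : Fin m => ℝ) a).comp
      L).contMDiff.comp hΓ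
  · have hW : ∀ᶠ x in 𝓝 x₀, x ∈ (chartAt E x₀).source ∧
        chartAt E x₀ x ∈ Metric.closedBall (chartAt E x₀ x₀) (r / 2) :=
      Eventually.and ((chartAt E x₀).open_source.mem_nhds (mem_chart_source E x₀))
        (((chartAt E x₀).continuousAt (mem_chart_source E x₀)).eventually
          (Metric.closedBall_mem_nhds _ (half_pos hr)))
    have h1 : ∀ᶠ q : M × M in 𝓝 (x₀, x₀), _ := continuousAt_fst.eventually hW
    have h2 : ∀ᶠ q : M × M in 𝓝 (x₀, x₀), _ := continuousAt_snd.eventually hW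
    filter_upwards [h1, h2] with q hq1 hq2 hq y hy
    have := hL ⟨_, hq1.2, rfl⟩ ⟨_, hq2.2, rfl⟩ (funext fun a => by
      simpa [(chartAt E x₀).left_inv hq1.1, (chartAt E x₀).left_inv hq2.1] using hq a)
    simp only [Function.comp_apply, (chartAt E x₀).left_inv hq1.1,
      (chartAt E x₀).left_inv hq2.1] at this
    exact DFunLike.congr_fun this ⟨y, hy⟩

open Classical in
/-- Evaluation at `y`, extended by zero to points outside the compact set. -/
noncomputable def evalOrZero (Y : Set N) [CompactSpace Y] (y : N) : C(Y, ℝ) →L[ℝ] ℝ :=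
  if h : y ∈ Y then ContinuousMap.evalCLM ℝ (⟨y, h⟩ : Y) else 0

theorem norm_evalOrZero_le (Y : Set N) [CompactSpace Y] (y : N) : ‖evalOrZero Y y‖ ≤ 1 := by
  by_cases h : y ∈ Y
  · rw [evalOrZero, dif_pos h]
    refine ContinuousLinearMap.opNorm_le_bound _ zero_le_one fun f => ?_
    rw [one_mul]
    exact f.norm_coe_le_norm _
  · rw [evalOrZero, dif_neg h, ContinuousLinearMap.opNorm_zero]
    exact zero_le_one

theorem evalOrZero_apply {Y : Set N} [CompactSpace Y] {y : N} (h : y ∈ Y) (f : C(N, ℝ)) :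
    evalOrZero Y y (f.restrict Y) = f y := by
  simp [evalOrZero, h]

/-- Maps into manifolds which are smooth when tested against globally defined smooth functions
can be plugged into a smooth function of two variables. -/
theorem contDiffAt_comp_of_test {V : Type*} [NormedAddCommGroup V] [InnerProductSpace ℝ V]
    [FiniteDimensional ℝ V] [FiniteDimensional ℝ E] [FiniteDimensional ℝ E'] {g : C(M × N, ℝ)}
    (hg : ContMDiff (𝓘(ℝ, E).prod 𝓘(ℝ, E')) 𝓘(ℝ, ℝ) ∞ g) {p : V → M} {q : V → N} {c : V}
    (hp : ∀ᶠ u in 𝓝 c, ContinuousAt p u) (hq : ∀ᶠ u in 𝓝 c, ContinuousAt q u)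
    (hps : ∀ h : M → ℝ, ContMDiff 𝓘(ℝ, E) 𝓘(ℝ, ℝ) ∞ h → ContDiffAt ℝ ∞ (h ∘ p) c)
    (hqs : ∀ h : N → ℝ, ContMDiff 𝓘(ℝ, E') 𝓘(ℝ, ℝ) ∞ h → ContDiffAt ℝ ∞ (h ∘ q) c) :
    ContDiffAt ℝ ∞ (fun u => g (p u, q u)) c := by
  borelize V
  have := ChartedSpace.locallyCompactSpace E M
  have := ChartedSpace.locallyCompactSpace E' N
  obtain ⟨X, hX, hXp⟩ := exists_compact_mem_nhds (p c)
  obtain ⟨Y, hY, hYq⟩ := exists_compact_mem_nhds (q c)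
  have := isCompact_iff_compactSpace.1 hX
  have := isCompact_iff_compactSpace.1 hY
  let g' : C(N × M, ℝ) := g.comp ContinuousMap.prodSwap
  have hΓ := contMDiff_curry_restrict hg Y
  have hΓ' := contMDiff_curry_restrict (contMDiff_comp_prodSwap hg) X
  have hpX : ∀ᶠ z : V × V in 𝓝 (c, c), p z.1 ∈ X :=
    continuousAt_fst.eventually (p := fun u => p u ∈ X) (hp.self_of_nhds.eventually hXp)
  have hqY : ∀ᶠ z : V × V in 𝓝 (c, c), q z.2 ∈ Y :=
    continuousAt_snd.eventually (p := fun u => q u ∈ Y) (hq.self_of_nhds.eventually hYq)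
  have key := contDiffAt_of_weakly_contDiffAt (c := c) (c' := c)
    (P := fun u => (g.curry (p u)).restrict Y) (P' := fun w => (g'.curry (q w)).restrict X)
    (δ := fun w => evalOrZero Y (q w)) (δ' := fun u => evalOrZero X (p u))
    (fun w => norm_evalOrZero_le Y _) (fun u => norm_evalOrZero_le X _)
    (by
      filter_upwards [hpX, hqY] with z h1 h2
      rw [evalOrZero_apply h1, evalOrZero_apply h2]
      rfl)
    (hp.mono fun u hu => hΓ.continuous.continuousAt.comp hu)
    (hq.mono fun u hu => hΓ'.continuous.continuousAt.comp hu)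
    (fun μ => hps _ (μ.contMDiff.comp hΓ)) (fun μ => hqs _ (μ.contMDiff.comp hΓ'))
  have hdiag : ContDiffAt ℝ ∞ (fun u : V => (u, u)) c := by fun_prop
  refine (ContDiffAt.comp (f := fun u : V => (u, u)) (g := fun z : V × V =>
    evalOrZero Y (q z.2) ((g.curry (p z.1)).restrict Y)) c key hdiag).congr_of_eventuallyEq ?_
  filter_upwards [hq.self_of_nhds.eventually hYq] with u hu
  exact (evalOrZero_apply hu (g.curry (p u))).symm

end Manifold

section Germs

variable {S : Type*} [TopologicalSpace S]

theorem IsLocRetr.exists_eventually_eq {C : Set C(S, ℝ)} {A U : Set S} {r : C(U, ↥(U ∩ A))}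
    (hr : IsLocRetr C A U r) (hU : IsOpen U) {x : S} (hx : x ∈ U) {h : C(↥(U ∩ A), ℝ)}
    (hh : h ∈ locExt C (U ∩ A)) :
    ∃ k ∈ C, ∀ᶠ z in 𝓝 x, ∀ hz : z ∈ U, h (r ⟨z, hz⟩) = k z := by
  obtain ⟨V, hV, hxV, k, hk, hkV⟩ := hr.2 h hh ⟨x, hx⟩
  refine ⟨k, hk, ?_⟩
  have h2 := hU.isOpenEmbedding_subtypeVal.isOpenMap _ hV
  filter_upwards [h2.mem_nhds ⟨⟨x, hx⟩, hxV, rfl⟩] with z hz hzU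
  obtain ⟨w, hw, rfl⟩ := hz
  exact hkV w hw

variable {E E' : Type} [NormedAddCommGroup E] [NormedSpace ℝ E]
  [NormedAddCommGroup E'] [NormedSpace ℝ E'] {M N : Type*}
  [TopologicalSpace M] [ChartedSpace E M] [TopologicalSpace N] [ChartedSpace E' N]

namespace Stratifold

attribute [local instance] Stratifold.charts

/-- The map `q` into a manifold is, near `x`, continuous and pulls smooth functions back into
the structure algebra. -/
def IsMorphismNear (T : Stratifold S) (E : Type) [NormedAddCommGroup E] [NormedSpace ℝ E]
    {M : Type*} [TopologicalSpace M] [ChartedSpace E M] (q : S → M) (x : S) : Prop :=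
  (∀ᶠ z in 𝓝 x, ContinuousAt q z) ∧
    ∀ h : M → ℝ, ContMDiff 𝓘(ℝ, E) 𝓘(ℝ, ℝ) ∞ h → ∃ k ∈ T.C, ∀ᶠ z in 𝓝 x, h (q z) = k z

variable {T : Stratifold S}

theorem IsMorphismNear.comp {Z : Type*} [TopologicalSpace Z] {TZ : Stratifold Z} {f : C(Z, S)}
    (hf : IsMor (TZ.C : Set C(Z, ℝ)) (T.C : Set C(S, ℝ)) f) {q : S → M} {z : Z}
    (hq : T.IsMorphismNear E q (f z)) : TZ.IsMorphismNear E (q ∘ f) z := by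
  refine ⟨?_, fun h hh => ?_⟩
  · filter_upwards [f.continuousAt z |>.eventually hq.1] with w hw
    exact hw.comp (f.continuousAt w)
  · obtain ⟨k, hk, hkq⟩ := hq.2 h hh
    exact ⟨k.comp f, hf k hk, f.continuousAt z |>.eventually hkq⟩

/-- A local retraction extends to a map defined everywhere which is a morphism near the base
point. -/
theorem exists_isMorphismNear_of_isLocRetr {i : ℕ} (x : T.strata i) {U : Set S} (hU : IsOpen U)
    (hx : (x : S) ∈ U) {r : C(U, ↥(U ∩ T.strata i))}
    (hr : IsLocRetr (T.C : Set C(S, ℝ)) (T.strata i) U r) :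
    ∃ R : S → T.strata i, (∀ a (ha : a ∈ U), (R a : S) = r ⟨a, ha⟩) ∧
      T.IsMorphismNear (EuclideanSpace ℝ (Fin i)) R x := by
  classical
  let R : S → T.strata i := fun a => if ha : a ∈ U then inclusion inter_subset_right (r ⟨a, ha⟩)
    else x
  have hR : ∀ a (ha : a ∈ U), R a = inclusion inter_subset_right (r ⟨a, ha⟩) := fun a ha =>
    dif_pos ha
  refine ⟨R, fun a ha => congrArg Subtype.val (hR a ha), ?_, fun h hh => ?_⟩
  · filter_upwards [hU.mem_nhds hx] with a ha
    refine ContinuousOn.continuousAt (continuousOn_iff_continuous_domRestrict.2 ?_)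
      (hU.mem_nhds ha)
    refine ((continuous_inclusion inter_subset_right).comp r.continuous).congr fun a => ?_
    exact (hR a a.2).symm
  · let h' : C(↥(U ∩ T.strata i), ℝ) := ⟨h ∘ inclusion inter_subset_right,
      hh.continuous.comp (continuous_inclusion inter_subset_right)⟩
    have hh' : h' ∈ locExt (T.C : Set C(S, ℝ)) (U ∩ T.strata i) := fun a => by
      obtain ⟨g, hg, V, hV, haV, hgV⟩ := T.germ_surj i (inclusion inter_subset_right a) h hh
      exact ⟨_, hV.preimage (continuous_inclusion inter_subset_right), haV, g, hg,
        fun b hb => (hgV _ hb).symm⟩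
    obtain ⟨k, hk, hkr⟩ := hr.exists_eventually_eq hU hx hh'
    refine ⟨k, hk, ?_⟩
    filter_upwards [hkr, hU.mem_nhds hx] with a ha haU
    rw [hR a haU]
    exact ha haU

theorem exists_retraction {i : ℕ} (x : T.strata i) :
    ∃ R : S → T.strata i, R x = x ∧
      (∀ᶠ a in 𝓝 (x : S), a ∈ T.strata i → (R a : S) = a) ∧
      T.IsMorphismNear (EuclideanSpace ℝ (Fin i)) R x := by
  obtain ⟨U, hU, hx, r, hr⟩ := T.retr i x x.2
  obtain ⟨R, hR, hRm⟩ := exists_isMorphismNear_of_isLocRetr x hU hx hr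
  have key : ∀ a ∈ U, a ∈ T.strata i → (R a : S) = a := fun a ha hai => by
    rw [hR a ha, hr.1 ⟨a, ha⟩ hai]
  exact ⟨R, Subtype.ext (key x hx x.2), mem_of_superset (hU.mem_nhds hx) key, hRm⟩

/-- Elements of the structure algebra factor locally through retractions. -/
theorem eventually_eq_comp_retraction {i : ℕ} {x : T.strata i} {R : S → T.strata i}
    (hR : ∀ᶠ a in 𝓝 (x : S), a ∈ T.strata i → (R a : S) = a)
    (hRm : T.IsMorphismNear (EuclideanSpace ℝ (Fin i)) R x)
    {k : C(S, ℝ)} (hk : k ∈ T.C) : ∀ᶠ a in 𝓝 (x : S), k a = k (R a) := by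
  obtain ⟨k', hk', hkk'⟩ := hRm.2 _ (T.restrict_smooth i k hk)
  obtain ⟨V, hV, hVo, hxV⟩ := eventually_nhds_iff.1 (hR.and hkk')
  obtain ⟨W, hW, hxW, hWk⟩ := T.germ_inj i x k hk k' hk'
    ⟨Subtype.val ⁻¹' V, hVo.preimage continuous_subtype_val, hxV, fun z hz => by
      rw [← (hV z hz).2, (hV z hz).1 z.2]⟩
  filter_upwards [hW.mem_nhds hxW, hkk'] with a h1 h2
  rw [hWk a h1, h2]

theorem IsMorphismNear.contMDiffAt {i : ℕ} [FiniteDimensional ℝ E] [FiniteDimensional ℝ E']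
    {x : T.strata i} {p : S → M} {q : S → N}
    (hp : T.IsMorphismNear E p x) (hq : T.IsMorphismNear E' q x) {g : C(M × N, ℝ)}
    (hg : ContMDiff (𝓘(ℝ, E).prod 𝓘(ℝ, E')) 𝓘(ℝ, ℝ) ∞ g) :
    ContMDiffAt 𝓘(ℝ, EuclideanSpace ℝ (Fin i)) 𝓘(ℝ, ℝ) ∞
      (fun z : T.strata i => g (p z, q z)) x := by
  let φ := chartAt (EuclideanSpace ℝ (Fin i)) x
  have hφ : ∀ᶠ u in 𝓝 (φ x), ContinuousAt (fun u => (φ.symm u : S)) u := by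
    filter_upwards [φ.open_target.mem_nhds (mem_chart_target _ x)] with u hu
    exact continuous_subtype_val.continuousAt.comp (φ.continuousAt_symm hu)
  have hφx : Tendsto (fun u => (φ.symm u : S)) (𝓝 (φ x)) (𝓝 x) := by
    have := hφ.self_of_nhds.tendsto
    rwa [φ.left_inv (mem_chart_source _ x)] at this
  have hsmooth : ∀ {f : S → ℝ}, (∃ k ∈ T.C, ∀ᶠ z in 𝓝 (x : S), f z = k z) →
      ContDiffAt ℝ ∞ (fun u => f (φ.symm u)) (φ x) := by
    rintro f ⟨k, hk, hfk⟩
    exact (contMDiffAt_real_iff.1 (T.restrict_smooth i k hk x)).2.congr_of_eventuallyEq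
      (hφx.eventually hfk)
  refine contMDiffAt_real_iff.2 ⟨?_, ?_⟩
  · exact g.continuous.continuousAt.comp
      ((hp.1.self_of_nhds.comp continuous_subtype_val.continuousAt).prodMk
        (hq.1.self_of_nhds.comp continuous_subtype_val.continuousAt))
  · exact contDiffAt_comp_of_test hg (hφ.mp ((hφx.eventually hp.1).mono fun _ => ContinuousAt.comp
        (f := fun u => (φ.symm u : S)) (g := p)))
      (hφ.mp ((hφx.eventually hq.1).mono fun _ => ContinuousAt.comp
        (f := fun u => (φ.symm u : S)) (g := q)))
      (fun h hh => hsmooth (hp.2 h hh)) (fun h hh => hsmooth (hq.2 h hh))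

theorem IsMorphismNear.eventually_eq_left {i : ℕ} [FiniteDimensional ℝ E]
    [FiniteDimensional ℝ E'] {x : T.strata i} {R : S → T.strata i} (hx : R x = x)
    (hR : ∀ᶠ a in 𝓝 (x : S), a ∈ T.strata i → (R a : S) = a)
    (hRm : T.IsMorphismNear (EuclideanSpace ℝ (Fin i)) R x)
    {p : S → M} (hp : T.IsMorphismNear E p x) {g : C(M × N, ℝ)}
    (hg : ContMDiff (𝓘(ℝ, E).prod 𝓘(ℝ, E')) 𝓘(ℝ, ℝ) ∞ g) {Y : Set N} (hY : IsCompact Y) :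
    ∀ᶠ a in 𝓝 (x : S), ∀ y ∈ Y, g (p a, y) = g (p (R a), y) := by
  obtain ⟨m, h, hh, hsep⟩ := exists_contMDiff_separating hg (p x) hY
  have hRc : Tendsto (fun a => (R a : S)) (𝓝 x) (𝓝 x) := by
    have := (continuous_subtype_val.continuousAt.comp hRm.1.self_of_nhds).tendsto
    simpa only [Function.comp_def, hx] using this
  have hpc := hp.1.self_of_nhds.tendsto
  have heq : ∀ᶠ a in 𝓝 (x : S), ∀ j, h j (p a) = h j (p (R a)) :=
    eventually_all.2 fun j => by
      obtain ⟨k, hk, hkp⟩ := hp.2 (h j) (hh j)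
      filter_upwards [hkp, hRc.eventually hkp, eventually_eq_comp_retraction hR hRm hk]
        with a h1 h2 h3
      rw [h1, h2, h3]
  filter_upwards [heq, (hpc.prodMk_nhds (hpc.comp hRc)).eventually hsep] with a h1 h2
  exact h2 h1

/-- Smooth functions of two morphisms into manifolds factor locally through retractions. -/
theorem IsMorphismNear.eventually_eq {i : ℕ} [FiniteDimensional ℝ E]
    [FiniteDimensional ℝ E'] {x : T.strata i} {R : S → T.strata i} (hx : R x = x)
    (hR : ∀ᶠ a in 𝓝 (x : S), a ∈ T.strata i → (R a : S) = a)
    (hRm : T.IsMorphismNear (EuclideanSpace ℝ (Fin i)) R x)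
    {p : S → M} (hp : T.IsMorphismNear E p x) {q : S → N} (hq : T.IsMorphismNear E' q x)
    {g : C(M × N, ℝ)} (hg : ContMDiff (𝓘(ℝ, E).prod 𝓘(ℝ, E')) 𝓘(ℝ, ℝ) ∞ g) :
    ∀ᶠ a in 𝓝 (x : S), g (p a, q a) = g (p (R a), q (R a)) := by
  have := ChartedSpace.locallyCompactSpace E M
  have := ChartedSpace.locallyCompactSpace E' N
  obtain ⟨X, hX, hXp⟩ := exists_compact_mem_nhds (p x)
  obtain ⟨Y, hY, hYq⟩ := exists_compact_mem_nhds (q x)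
  have hRc : Tendsto (fun a => (R a : S)) (𝓝 x) (𝓝 x) := by
    have := (continuous_subtype_val.continuousAt.comp hRm.1.self_of_nhds).tendsto
    simpa only [Function.comp_def, hx] using this
  filter_upwards [eventually_eq_left hx hR hRm hp hg hY,
    eventually_eq_left hx hR hRm hq (contMDiff_comp_prodSwap hg) hX,
    hq.1.self_of_nhds.eventually hYq,
    hRc.eventually (hp.1.self_of_nhds.eventually hXp)] with a h1 h2 h3 h4
  rw [h1 _ h3]
  exact h2 _ h4

variable {S' Z : Type*} [TopologicalSpace S'] [TopologicalSpace Z]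

/-- Elements of the structure algebra of a product are, along a pair of morphisms, locally
given by smooth functions on products of strata. -/
theorem exists_eventually_eq_of_mem_prodAlg {TZ : Stratifold Z} {T' : Stratifold S'}
    {f₁ : C(Z, S)} {f₂ : C(Z, S')}
    (h₁ : IsMor (TZ.C : Set C(Z, ℝ)) (T.C : Set C(S, ℝ)) f₁)
    (h₂ : IsMor (TZ.C : Set C(Z, ℝ)) (T'.C : Set C(S', ℝ)) f₂)
    {g : C(S × S', ℝ)} (hg : g ∈ prodAlg T T') (z : Z) :
    ∃ i j, ∃ (g' : C(T.strata i × T'.strata j, ℝ)) (p : Z → T.strata i) (q : Z → T'.strata j),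
      ContMDiff (𝓘(ℝ, EuclideanSpace ℝ (Fin i)).prod 𝓘(ℝ, EuclideanSpace ℝ (Fin j)))
        𝓘(ℝ, ℝ) ∞ g' ∧
      TZ.IsMorphismNear (EuclideanSpace ℝ (Fin i)) p z ∧
      TZ.IsMorphismNear (EuclideanSpace ℝ (Fin j)) q z ∧
      ∀ᶠ w in 𝓝 z, g (f₁ w, f₂ w) = g' (p w, q w) := by
  obtain ⟨i, hi⟩ := mem_iUnion.1 (T.strata_cover.symm ▸ mem_univ (f₁ z))
  obtain ⟨j, hj⟩ := mem_iUnion.1 (T'.strata_cover.symm ▸ mem_univ (f₂ z))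
  obtain ⟨U, V, hU, hxU, hV, hyV, r, r', hr, hr', hgr⟩ := hg.2 i j _ _ hi hj
  obtain ⟨R, hR, hRm⟩ := exists_isMorphismNear_of_isLocRetr ⟨_, hi⟩ hU hxU hr
  obtain ⟨R', hR', hRm'⟩ := exists_isMorphismNear_of_isLocRetr ⟨_, hj⟩ hV hyV hr'
  refine ⟨i, j, g.comp ((ContinuousMap.mk Subtype.val).prodMap (ContinuousMap.mk Subtype.val)),
    R ∘ f₁, R' ∘ f₂, hg.1 i j, IsMorphismNear.comp h₁ hRm, IsMorphismNear.comp h₂ hRm', ?_⟩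
  filter_upwards [f₁.continuousAt z |>.eventually (hU.mem_nhds hxU),
    f₂.continuousAt z |>.eventually (hV.mem_nhds hyV)] with w h1 h2
  have := hgr ⟨_, h1⟩ ⟨_, h2⟩
  rw [← hR _ h1, ← hR' _ h2] at this
  exact this.symm

theorem isMor_prodMk {TZ : Stratifold Z} {T' : Stratifold S'} {f₁ : C(Z, S)} {f₂ : C(Z, S')}
    (h₁ : IsMor (TZ.C : Set C(Z, ℝ)) (T.C : Set C(S, ℝ)) f₁)
    (h₂ : IsMor (TZ.C : Set C(Z, ℝ)) (T'.C : Set C(S', ℝ)) f₂) :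
    IsMor (TZ.C : Set C(Z, ℝ)) (prodAlg T T') (f₁.prodMk f₂) := by
  intro g hg
  refine TZ.locallyDetectable _ fun z => ?_
  obtain ⟨l, hl⟩ := mem_iUnion.1 (TZ.strata_cover.symm ▸ mem_univ z)
  obtain ⟨R, hRz, hR, hRm⟩ := exists_retraction (T := TZ) ⟨z, hl⟩
  have hsmooth : ContMDiff 𝓘(ℝ, EuclideanSpace ℝ (Fin l)) 𝓘(ℝ, ℝ) ∞
      fun w : TZ.strata l => g (f₁ w, f₂ w) := fun w => by
    obtain ⟨i, j, g', p, q, hg', hp, hq, hpq⟩ :=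
      exists_eventually_eq_of_mem_prodAlg h₁ h₂ hg (w : Z)
    exact (hp.contMDiffAt hq hg').congr_of_eventuallyEq
      (continuous_subtype_val.continuousAt.eventually hpq)
  obtain ⟨k, hk, hkR⟩ := hRm.2 _ hsmooth
  obtain ⟨i, j, g', p, q, hg', hp, hq, hpq⟩ := exists_eventually_eq_of_mem_prodAlg h₁ h₂ hg z
  have hRc : Tendsto (fun a => (R a : Z)) (𝓝 z) (𝓝 z) := by
    have := (continuous_subtype_val.continuousAt.comp hRm.1.self_of_nhds).tendsto
    simpa only [Function.comp_def, hRz] using this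
  have hfin : ∀ᶠ w in 𝓝 z, g (f₁ w, f₂ w) = k w := by
    filter_upwards [hpq, hRc.eventually hpq, hkR,
      IsMorphismNear.eventually_eq (x := ⟨z, hl⟩) hRz hR hRm hp hq hg'] with w a1 a2 a3 a4
    rw [a1, a4, ← a2, a3]
  obtain ⟨W, hW, hWo, hzW⟩ := eventually_nhds_iff.1 hfin
  exact ⟨W, hWo, hzW, k, hk, hW⟩

end Stratifold

end Germs

end

/-- the product of two stratifolds, with structure algebra `𝒞_{S×S'}`,
is the categorical (cartesian) product in the category of stratifolds: for morphisms of
stratifolds `f₁ : Z → S` and `f₂ : Z → S'`, the map `z ↦ (f₁ z, f₂ z)` is a morphism of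
stratifolds `Z → S × S'`, and it is the unique morphism commuting with the two
projections. -/
theorem stmt16 {Z S S' : Type*} [TopologicalSpace Z] [TopologicalSpace S]
    [TopologicalSpace S'] (TZ : Stratifold Z) (T : Stratifold S) (T' : Stratifold S')
    (f₁ : C(Z, S)) (f₂ : C(Z, S'))
    (h₁ : IsMor (TZ.C : Set C(Z, ℝ)) (T.C : Set C(S, ℝ)) f₁)
    (h₂ : IsMor (TZ.C : Set C(Z, ℝ)) (T'.C : Set C(S', ℝ)) f₂) :
    ∃! F : C(Z, S × S'), IsMor (TZ.C : Set C(Z, ℝ)) (prodAlg T T') F ∧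
      ContinuousMap.fst.comp F = f₁ ∧ ContinuousMap.snd.comp F = f₂ := by
  refine ⟨f₁.prodMk f₂, ⟨Stratifold.isMor_prodMk h₁ h₂, rfl, rfl⟩, ?_⟩
  rintro F ⟨-, rfl, rfl⟩
  rfl
end
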